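/- For every call sequence σ there exists a pair-epistemically non-redundant call sequence τ such that for every formula φ of L_wn: (M, σ) ⊨ φ if and only if (M, τ) ⊨ φ. -/

import Mathlib

namespace Gossip

/-- A call between two distinct agents. -/
structure Call (A : Type) where
  x : A
  y : A
  ne : x ≠ y

variable {A : Type} [DecidableEq A]

/-- Agent `a` is involved in the call `c`. -/
def Call.involves (c : Call A) (a : A) : Prop := a = c.x ∨ a = c.y

instance (c : Call A) (a : A) : Decidable (c.involves a) := by
  unfold Call.involves; infer_instance

/-- `c` is the call between agents `a` and `b`. -/
def Call.isBetween (c : Call A) (a b : A) : Prop :=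
  (c.x = a ∧ c.y = b) ∨ (c.x = b ∧ c.y = a)

instance (c : Call A) (a b : A) : Decidable (c.isBetween a b) := by
  unfold Call.isBetween; infer_instance

/-- The effect of a call on a gossip situation: the two agents involved
pool their secrets. -/
def Call.apply (c : Call A) (s : A → Finset A) : A → Finset A :=
  fun d => if d = c.x ∨ d = c.y then s c.x ∪ s c.y else s d

/-- The initial gossip situation: each agent is familiar only with their
own secret (secrets are identified with agents via the fixed bijection). -/
def root : A → Finset A := fun a => {a}

/-- The result of applying a call sequence to a gossip situation. -/
def applySeq (σ : List (Call A)) (s : A → Finset A) : A → Finset A :=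
  σ.foldl (fun t c => c.apply t) s

/-- `∼_a` : the smallest relation with `ε ∼_a ε`, closed under appending
calls not involving `a` on either side, and under appending a call
involving `a` on both sides when it yields the same set of secrets for `a`. -/
inductive AgEquiv (a : A) : List (Call A) → List (Call A) → Prop
  | nil : AgEquiv a [] []
  | extLeft {σ τ : List (Call A)} (c : Call A) :
      ¬ c.involves a → AgEquiv a σ τ → AgEquiv a (σ ++ [c]) τ
  | extRight {σ τ : List (Call A)} (c : Call A) :
      ¬ c.involves a → AgEquiv a σ τ → AgEquiv a σ (τ ++ [c])
  | call {σ τ : List (Call A)} (c : Call A) :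
      c.involves a →
      applySeq (σ ++ [c]) root a = applySeq (τ ++ [c]) root a →
      AgEquiv a σ τ → AgEquiv a (σ ++ [c]) (τ ++ [c])

/-- `∼_G` : reflexive-transitive closure of the union of the `∼_a`, `a ∈ G`. -/
def GEquiv (G : Finset A) : List (Call A) → List (Call A) → Prop :=
  Relation.ReflTransGen (fun σ τ => ∃ a ∈ G, AgEquiv a σ τ)

/-- Formulas of the language `L^ck`. `fam a p` is `F_a p`,
`ck G φ` is `C_G φ`; `K_a φ` is `ck {a} φ`. -/
inductive Formula (A : Type) where
  | fam : A → A → Formula A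
  | neg : Formula A → Formula A
  | conj : Formula A → Formula A → Formula A
  | ck : Finset A → Formula A → Formula A

/-- Truth of a formula at a call sequence (in the gossip model). -/
def Sat : Formula A → List (Call A) → Prop
  | .fam a p, σ => p ∈ applySeq σ root a
  | .neg φ, σ => ¬ Sat φ σ
  | .conj φ ψ, σ => Sat φ σ ∧ Sat ψ σ
  | .ck G φ, σ => ∀ τ, GEquiv G σ τ → Sat φ τ

/-- `M ⊨ φ` : truth at every call sequence. -/
def Truth (φ : Formula A) : Prop := ∀ σ : List (Call A), Sat φ σ

/-- Formulas with no occurrence of the negation symbol. -/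
def NegFree : Formula A → Prop
  | .fam _ _ => True
  | .neg _ => False
  | .conj φ ψ => NegFree φ ∧ NegFree ψ
  | .ck _ φ => NegFree φ

/-- Formulas with no occurrence of the `C_G` modalities (propositional part). -/
def CkFree : Formula A → Prop
  | .fam _ _ => True
  | .neg φ => CkFree φ
  | .conj φ ψ => CkFree φ ∧ CkFree ψ
  | .ck _ _ => False

/-- Formulas of `L_wn`: no nested occurrence of the `C_G` modalities. -/
def NoNested : Formula A → Prop
  | .fam _ _ => True
  | .neg φ => NoNested φ
  | .conj φ ψ => NoNested φ ∧ NoNested ψ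
  | .ck _ φ => CkFree φ

/-- The call `ab` occurs in `σ`. -/
def occursBetween (a b : A) (σ : List (Call A)) : Prop :=
  ∃ c ∈ σ, c.isBetween a b

/-- Epistemic pair-view component `Ṽ(σ)(a,b)`. -/
def pairView (σ : List (Call A)) (a b : A) : Set (A → Finset A) :=
  {s | ∃ τ, GEquiv {a, b} σ τ ∧ s = applySeq τ root}

/-- The full epistemic pair-view `Ṽ(σ)` : all components `Ṽ(σ)(a,b)`
together with the designated situation `Ṽ(σ)(*) = σ(root)`. -/
def fullView (σ : List (Call A)) : (A → A → Set (A → Finset A)) × (A → Finset A) :=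
  (pairView σ, applySeq σ root)

/-- A call sequence is pair-epistemically non-redundant if no nonempty
subsequence `σ₂` of a prefix `σ₁.σ₂` is pair-epistemically redundant. -/
def PairNonRedundant (σ : List (Call A)) : Prop :=
  ∀ σ₁ σ₂ : List (Call A), (σ₁ ++ σ₂) <+: σ → σ₂ ≠ [] →
    fullView σ₁ ≠ fullView (σ₁ ++ σ₂)

/-- Order on gossip situations: componentwise inclusion. -/
def gsLE (s t : A → Finset A) : Prop := ∀ a, s a ⊆ t a

/-- The order `≤_EPV` on (the pair components of) epistemic pair-views. -/
def epvLE (V W : A → A → Set (A → Finset A)) : Prop :=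
  ∀ a b : A, ∃ X : Set (A → Finset A), X ⊆ V a b ∧
    ∃ g : X → W a b, Function.Surjective g ∧ ∀ s : X, gsLE s.1 (g s).1

/-- `σ` is ab-redundant free: no call of `σ` different from the call `ab`
is redundant (leaves the current gossip situation unchanged). -/
def abRedundantFree (a b : A) (σ : List (Call A)) : Prop :=
  ∀ (i : ℕ) (h : i < σ.length), ¬ (σ.get ⟨i, h⟩).isBetween a b →
    (σ.get ⟨i, h⟩).apply (applySeq (σ.take i) root) ≠ applySeq (σ.take i) root

set_option linter.unusedSectionVars false

section Views

theorem Call.apply_of_involves {c : Call A} {d : A} (h : c.involves d) (s : A → Finset A) :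
    c.apply s d = s c.x ∪ s c.y := if_pos h

theorem Call.apply_of_not_involves {c : Call A} {d : A} (h : ¬ c.involves d)
    (s : A → Finset A) : c.apply s d = s d := if_neg h

theorem Call.exists_partner {c : Call A} {a : A} (h : c.involves a) :
    ∃ x, x ≠ a ∧ (∀ d, c.involves d ↔ d = a ∨ d = x) ∧
      ∀ s : A → Finset A, s c.x ∪ s c.y = s a ∪ s x := by
  rcases h with rfl | rfl
  · exact ⟨c.y, c.ne.symm, fun d => Iff.rfl, fun s => rfl⟩
  · exact ⟨c.x, c.ne, fun d => or_comm, fun s => Finset.union_comm _ _⟩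

theorem Call.union_eq_of_involves {c : Call A} {a b : A} (hab : a ≠ b) (ha : c.involves a)
    (hb : c.involves b) (s : A → Finset A) : s c.x ∪ s c.y = s a ∪ s b := by
  obtain ⟨x, -, h, hs⟩ := Call.exists_partner ha
  rcases (h b).1 hb with rfl | rfl
  · exact absurd rfl hab
  · exact hs s

theorem Call.subset_apply (c : Call A) (s : A → Finset A) (d : A) : s d ⊆ c.apply s d := by
  by_cases h : c.involves d
  · rw [Call.apply_of_involves h]
    rcases h with rfl | rfl
    · exact Finset.subset_union_left
    · exact Finset.subset_union_right
  · rw [Call.apply_of_not_involves h]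

@[simp] theorem applySeq_nil (s : A → Finset A) : applySeq ([] : List (Call A)) s = s := rfl

@[simp] theorem applySeq_cons (c : Call A) (l : List (Call A)) (s : A → Finset A) :
    applySeq (c :: l) s = applySeq l (c.apply s) := rfl

@[simp] theorem applySeq_append (l m : List (Call A)) (s : A → Finset A) :
    applySeq (l ++ m) s = applySeq m (applySeq l s) := List.foldl_append

theorem subset_applySeq (l : List (Call A)) (s : A → Finset A) (d : A) :
    s d ⊆ applySeq l s d := by
  induction l generalizing s with
  | nil => exact subset_rfl
  | cons c l ih => exact (c.subset_apply s d).trans (ih _)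

theorem mem_applySeq_self {s : A → Finset A} (hs : ∀ x, x ∈ s x) (l : List (Call A)) (x : A) :
    x ∈ applySeq l s x := subset_applySeq l s x (hs x)

theorem mem_root_self (x : A) : x ∈ root x := Finset.mem_singleton_self x

/-- The calls of `l` that agent `a` takes part in, each with the secrets `a` holds after it,
when `l` is executed from the situation `s`. -/
def viewFrom (a : A) : (A → Finset A) → List (Call A) → List (Call A × Finset A)
  | _, [] => []
  | s, c :: l =>
    if c.involves a then (c, c.apply s a) :: viewFrom a (c.apply s) l
    else viewFrom a (c.apply s) l

@[simp] theorem viewFrom_nil (a : A) (s : A → Finset A) : viewFrom a s [] = [] := rfl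

theorem viewFrom_cons (a : A) (s : A → Finset A) (c : Call A) (l : List (Call A)) :
    viewFrom a s (c :: l) = if c.involves a then (c, c.apply s a) :: viewFrom a (c.apply s) l
      else viewFrom a (c.apply s) l := rfl

theorem viewFrom_cons_of {a : A} {c : Call A} (h : c.involves a) (s : A → Finset A)
    (l : List (Call A)) :
    viewFrom a s (c :: l) = (c, c.apply s a) :: viewFrom a (c.apply s) l := if_pos h

theorem viewFrom_cons_of_not {a : A} {c : Call A} (h : ¬ c.involves a) (s : A → Finset A)
    (l : List (Call A)) : viewFrom a s (c :: l) = viewFrom a (c.apply s) l := if_neg h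

theorem viewFrom_append (a : A) (s : A → Finset A) (l m : List (Call A)) :
    viewFrom a s (l ++ m) = viewFrom a s l ++ viewFrom a (applySeq l s) m := by
  induction l generalizing s with
  | nil => rfl
  | cons c l ih =>
    rw [List.cons_append, viewFrom_cons, viewFrom_cons, ih]
    split <;> rfl

theorem viewFrom_eq_nil {a : A} {l : List (Call A)} (h : ∀ c ∈ l, ¬ c.involves a)
    (s : A → Finset A) : viewFrom a s l = [] := by
  induction l generalizing s with
  | nil => rfl
  | cons c l ih =>
    rw [viewFrom_cons_of_not (h c (by simp))]
    exact ih (fun d hd => h d (by simp [hd])) _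

theorem not_involves_of_viewFrom_eq_nil {a : A} {l : List (Call A)} {s : A → Finset A}
    (h : viewFrom a s l = []) : ∀ c ∈ l, ¬ c.involves a := by
  induction l generalizing s with
  | nil => simp
  | cons c l ih =>
    by_cases hc : c.involves a
    · simp [viewFrom_cons_of hc] at h
    · rw [viewFrom_cons_of_not hc] at h
      simpa [hc] using ih h

theorem mem_of_mem_viewFrom {a : A} {l : List (Call A)} {s : A → Finset A}
    {p : Call A × Finset A} (h : p ∈ viewFrom a s l) : p.1 ∈ l := by
  induction l generalizing s with
  | nil => simp at h
  | cons c l ih =>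
    rw [viewFrom_cons] at h
    split at h
    · rcases List.mem_cons.1 h with rfl | h
      · simp
      · exact List.mem_cons_of_mem _ (ih h)
    · exact List.mem_cons_of_mem _ (ih h)

theorem exists_mem_viewFrom {a : A} {l : List (Call A)} {c : Call A} (hc : c ∈ l)
    (ha : c.involves a) (s : A → Finset A) : ∃ p ∈ viewFrom a s l, p.1 = c := by
  induction l generalizing s with
  | nil => simp at hc
  | cons e l ih =>
    rcases List.mem_cons.1 hc with rfl | h
    · exact ⟨_, by rw [viewFrom_cons_of ha]; exact List.mem_cons_self, rfl⟩
    · obtain ⟨p, hp, rfl⟩ := ih h (e.apply s)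
      refine ⟨p, ?_, rfl⟩
      rw [viewFrom_cons]
      split
      · exact List.mem_cons_of_mem _ hp
      · exact hp

/-- The secrets held by an agent are determined by its view. -/
theorem applySeq_eq_foldl_viewFrom (a : A) (l : List (Call A)) (s : A → Finset A) :
    applySeq l s a = (viewFrom a s l).foldl (fun _ p => p.2) (s a) := by
  induction l generalizing s with
  | nil => rfl
  | cons c l ih =>
    rw [applySeq_cons, ih, viewFrom_cons]
    split
    · rfl
    · next h => rw [Call.apply_of_not_involves h]

theorem applySeq_eq_of_viewFrom_eq {a : A} {l m : List (Call A)} {s t : A → Finset A}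
    (h : viewFrom a s l = viewFrom a t m) (hs : s a = t a) :
    applySeq l s a = applySeq m t a := by
  rw [applySeq_eq_foldl_viewFrom, applySeq_eq_foldl_viewFrom, h, hs]

theorem applySeq_of_not_involves {a : A} {l : List (Call A)} (h : ∀ c ∈ l, ¬ c.involves a)
    (s : A → Finset A) : applySeq l s a = s a := by
  rw [applySeq_eq_foldl_viewFrom, viewFrom_eq_nil h]; rfl

theorem applySeq_eq_or_exists_mem_viewFrom (a : A) (l : List (Call A)) (s : A → Finset A) :
    applySeq l s a = s a ∨ ∃ p ∈ viewFrom a s l, p.2 = applySeq l s a := by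
  rw [applySeq_eq_foldl_viewFrom]
  rcases List.eq_nil_or_concat (viewFrom a s l) with h | ⟨v, p, h⟩
  · rw [h]; exact Or.inl rfl
  · rw [h]; exact Or.inr ⟨p, by simp, by simp⟩

theorem viewFrom_root_eq_of_agEquiv {a : A} {σ τ : List (Call A)} (h : AgEquiv a σ τ) :
    viewFrom a root σ = viewFrom a root τ := by
  induction h with
  | nil => rfl
  | extLeft c hc _ ih => rw [viewFrom_append, viewFrom_cons_of_not hc, ← ih]; simp
  | extRight c hc _ ih => rw [viewFrom_append, viewFrom_cons_of_not hc, ih]; simp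
  | call c hc he _ ih =>
    rw [viewFrom_append, viewFrom_append, viewFrom_cons_of hc, viewFrom_cons_of hc, ih]
    simp only [applySeq_append, applySeq_cons, applySeq_nil] at he
    rw [he]; rfl

theorem agEquiv_of_viewFrom_root_eq {a : A} {σ τ : List (Call A)}
    (h : viewFrom a root σ = viewFrom a root τ) : AgEquiv a σ τ := by
  induction σ using List.reverseRecOn generalizing τ with
  | nil =>
    induction τ using List.reverseRecOn with
    | nil => exact .nil
    | append_singleton τ c ih =>
      have hc := not_involves_of_viewFrom_eq_nil h.symm
      refine .extRight c (hc c (by simp)) (ih ?_)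
      exact (viewFrom_eq_nil (fun d hd => hc d (by simp [hd])) _).symm
  | append_singleton σ c ihσ =>
    by_cases hc : c.involves a
    · induction τ using List.reverseRecOn with
      | nil =>
        exact absurd hc (not_involves_of_viewFrom_eq_nil h c (by simp))
      | append_singleton τ d ihτ =>
        by_cases hd : d.involves a
        · rw [viewFrom_append, viewFrom_append, viewFrom_cons_of hc, viewFrom_cons_of hd] at h
          obtain ⟨h1, h2⟩ := List.append_inj' h rfl
          simp only [viewFrom_nil, List.cons.injEq, Prod.mk.injEq, and_true] at h2
          obtain ⟨rfl, h2⟩ := h2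
          refine .call c hc ?_ (ihσ h1)
          simpa using h2
        · refine .extRight d hd (ihτ ?_)
          rw [h, viewFrom_append, viewFrom_cons_of_not hd]; simp
    · refine .extLeft c hc (ihσ ?_)
      rw [← h, viewFrom_append, viewFrom_cons_of_not hc]; simp

theorem agEquiv_iff {a : A} {σ τ : List (Call A)} :
    AgEquiv a σ τ ↔ viewFrom a root σ = viewFrom a root τ :=
  ⟨viewFrom_root_eq_of_agEquiv, agEquiv_of_viewFrom_root_eq⟩

theorem GEquiv.trans {G : Finset A} {σ τ υ : List (Call A)} (h : GEquiv G σ τ)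
    (h' : GEquiv G τ υ) : GEquiv G σ υ := Relation.ReflTransGen.trans h h'

theorem GEquiv.symm {G : Finset A} {σ τ : List (Call A)} (h : GEquiv G σ τ) :
    GEquiv G τ σ := by
  have : Std.Symm fun σ τ : List (Call A) => ∃ a ∈ G, AgEquiv a σ τ :=
    ⟨fun _ _ ⟨a, ha, h⟩ => ⟨a, ha, agEquiv_iff.2 (agEquiv_iff.1 h).symm⟩⟩
  exact Relation.ReflTransGen.stdSymm.symm _ _ h

theorem GEquiv.of_viewFrom_eq {G : Finset A} {a : A} (ha : a ∈ G) {σ τ : List (Call A)}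
    (h : viewFrom a root σ = viewFrom a root τ) : GEquiv G σ τ :=
  .single ⟨a, ha, agEquiv_iff.2 h⟩

theorem GEquiv.append_call {G : Finset A} {a : A} (ha : a ∈ G) {c : Call A}
    (hc : c.involves a) {σ τ : List (Call A)} (h : viewFrom a root σ = viewFrom a root τ)
    (hS : c.apply (applySeq σ root) a = c.apply (applySeq τ root) a) :
    GEquiv G (σ ++ [c]) (τ ++ [c]) := by
  refine .of_viewFrom_eq ha ?_
  rw [viewFrom_append, viewFrom_append, h, viewFrom_cons_of hc, viewFrom_cons_of hc, hS]
  rfl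

theorem gEquiv_append_of_not_involves {G : Finset A} {a : A} (ha : a ∈ G) {c : Call A}
    (hc : ¬ c.involves a) (σ : List (Call A)) : GEquiv G (σ ++ [c]) σ := by
  refine .of_viewFrom_eq ha ?_
  rw [viewFrom_append, viewFrom_cons_of_not hc]; simp

theorem gEquiv_append_of_not_both {a b : A} {ρ : List (Call A)}
    (h : ∀ c ∈ ρ, ¬ (c.involves a ∧ c.involves b)) (σ : List (Call A)) :
    GEquiv {a, b} (σ ++ ρ) σ := by
  induction ρ using List.reverseRecOn with
  | nil => rw [List.append_nil]; exact .refl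
  | append_singleton ρ c ih =>
    rw [← List.append_assoc]
    refine GEquiv.trans ?_ (ih fun d hd => h d (by simp [hd]))
    by_cases hc : c.involves a
    · exact gEquiv_append_of_not_involves (a := b) (by simp)
        (fun hb => h c (by simp) ⟨hc, hb⟩) _
    · exact gEquiv_append_of_not_involves (a := a) (by simp) hc _

theorem exists_split_of_viewFrom_eq {a : A} {s : A → Finset A} {υ : List (Call A)}
    {v w : List (Call A × Finset A)} {c : Call A} {R : Finset A}
    (h : viewFrom a s υ = v ++ (c, R) :: w) :
    ∃ υ₀ ρ, υ = υ₀ ++ c :: ρ ∧ viewFrom a s υ₀ = v ∧ c.apply (applySeq υ₀ s) a = R ∧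
      viewFrom a (applySeq (υ₀ ++ [c]) s) ρ = w := by
  induction υ generalizing s v with
  | nil => simp at h
  | cons d υ ih =>
    by_cases hd : d.involves a
    · rw [viewFrom_cons_of hd] at h
      cases v with
      | nil =>
        simp only [List.nil_append, List.cons.injEq, Prod.mk.injEq] at h
        obtain ⟨⟨rfl, h1⟩, h2⟩ := h
        exact ⟨[], υ, rfl, rfl, h1, h2⟩
      | cons p v =>
        simp only [List.cons_append, List.cons.injEq] at h
        obtain ⟨υ₀, ρ, rfl, h1, h2, h3⟩ := ih h.2
        exact ⟨d :: υ₀, ρ, rfl, by rw [viewFrom_cons_of hd, h.1, h1], h2, h3⟩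
    · rw [viewFrom_cons_of_not hd] at h
      obtain ⟨υ₀, ρ, rfl, h1, h2, h3⟩ := ih h
      exact ⟨d :: υ₀, ρ, rfl, by rw [viewFrom_cons_of_not hd, h1], h2, h3⟩

theorem exists_split_of_agEquiv {a b : A} {e : Call A} (ha : e.involves a)
    {σ₀ ρ τ : List (Call A)} (hρ : ∀ c ∈ ρ, ¬ (c.involves a ∧ c.involves b))
    (h : AgEquiv a (σ₀ ++ e :: ρ) τ) :
    ∃ τ₀ ρ', τ = τ₀ ++ e :: ρ' ∧ (∀ c ∈ ρ', ¬ (c.involves a ∧ c.involves b)) ∧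
      viewFrom a root σ₀ = viewFrom a root τ₀ ∧
      viewFrom a root (σ₀ ++ [e]) = viewFrom a root (τ₀ ++ [e]) := by
  have h := (agEquiv_iff.1 h).symm
  rw [viewFrom_append, viewFrom_cons_of ha] at h
  obtain ⟨τ₀, ρ', rfl, h1, h2, h3⟩ := exists_split_of_viewFrom_eq h
  refine ⟨τ₀, ρ', rfl, ?_, h1.symm, ?_⟩
  · rintro c hc ⟨hca, hcb⟩
    obtain ⟨p, hp, rfl⟩ := exists_mem_viewFrom hc hca (applySeq (τ₀ ++ [e]) root)
    rw [h3] at hp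
    exact hρ _ (mem_of_mem_viewFrom hp) ⟨hca, hcb⟩
  · rw [viewFrom_append, viewFrom_append, h1, viewFrom_cons_of ha, viewFrom_cons_of ha, h2]
    rfl

end Views

section Closed

/-- All agents taking part in calls of `l` belong to `R`. -/
def Within (R : Finset A) (l : List (Call A)) : Prop := ∀ c ∈ l, c.x ∈ R ∧ c.y ∈ R

/-- No secret has passed the border of `R`, and agents outside `R` know only their own. -/
def Closed (R : Finset A) (s : A → Finset A) : Prop :=
  (∀ x ∈ R, s x ⊆ R) ∧ ∀ x ∉ R, s x = {x}

theorem Within.append {R : Finset A} {l m : List (Call A)} (hl : Within R l)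
    (hm : Within R m) : Within R (l ++ m) := by
  intro c hc
  rcases List.mem_append.1 hc with h | h
  exacts [hl c h, hm c h]

theorem Within.singleton {R : Finset A} {x y : A} (h : x ≠ y) (hx : x ∈ R) (hy : y ∈ R) :
    Within R [⟨x, y, h⟩] := by
  intro c hc
  obtain rfl := List.mem_singleton.1 hc
  exact ⟨hx, hy⟩

theorem Within.mem_of_involves {R : Finset A} {l : List (Call A)} (h : Within R l)
    {c : Call A} (hc : c ∈ l) {a : A} (ha : c.involves a) : a ∈ R := by
  rcases ha with rfl | rfl
  exacts [(h c hc).1, (h c hc).2]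

theorem Closed.apply {R : Finset A} {s : A → Finset A} (h : Closed R s) {c : Call A}
    (hx : c.x ∈ R) (hy : c.y ∈ R) : Closed R (c.apply s) := by
  refine ⟨fun x hxR => ?_, fun x hxR => ?_⟩
  · by_cases hc : c.involves x
    · rw [Call.apply_of_involves hc]
      exact Finset.union_subset (h.1 _ hx) (h.1 _ hy)
    · rw [Call.apply_of_not_involves hc]
      exact h.1 x hxR
  · rw [Call.apply_of_not_involves]
    · exact h.2 x hxR
    · rintro (rfl | rfl)
      exacts [hxR hx, hxR hy]

theorem Closed.applySeq {R : Finset A} {s : A → Finset A} (h : Closed R s)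
    {l : List (Call A)} (hl : Within R l) : Closed R (applySeq l s) := by
  induction l generalizing s with
  | nil => exact h
  | cons c l ih =>
    exact ih (h.apply (hl c (by simp)).1 (hl c (by simp)).2) fun d hd => hl d (by simp [hd])

theorem closed_root (R : Finset A) : Closed R root :=
  ⟨fun _ hx => Finset.singleton_subset_iff.2 hx, fun _ _ => rfl⟩

theorem Closed.mono {R R' : Finset A} {s : A → Finset A} (h : Closed R s) (hR : R ⊆ R') :
    Closed R' s := by
  refine ⟨fun x hx => ?_, fun x hx => h.2 x fun h' => hx (hR h')⟩
  by_cases hxR : x ∈ R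
  · exact (h.1 x hxR).trans hR
  · rw [h.2 x hxR]; exact Finset.singleton_subset_iff.2 hx

theorem apply_eqOn {R : Finset A} {s t : A → Finset A} (hst : ∀ x ∈ R, s x = t x)
    {c : Call A} (hx : c.x ∈ R) (hy : c.y ∈ R) : ∀ x ∈ R, c.apply s x = c.apply t x := by
  intro x hxR
  by_cases hc : c.involves x
  · rw [Call.apply_of_involves hc, Call.apply_of_involves hc, hst _ hx, hst _ hy]
  · rw [Call.apply_of_not_involves hc, Call.apply_of_not_involves hc, hst _ hxR]

theorem viewFrom_congr {R : Finset A} (a : A) {l : List (Call A)} (hl : Within R l)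
    {s t : A → Finset A} (hst : ∀ x ∈ R, s x = t x) : viewFrom a s l = viewFrom a t l := by
  induction l generalizing s t with
  | nil => rfl
  | cons c l ih =>
    have hc := hl c (by simp)
    rw [viewFrom_cons, viewFrom_cons,
      ih (fun d hd => hl d (by simp [hd])) (apply_eqOn hst hc.1 hc.2)]
    split
    · next h =>
      rw [Call.apply_of_involves h, Call.apply_of_involves h, hst _ hc.1, hst _ hc.2]
    · rfl

/-- Every agent of the list `l`, in order, calls `x`. -/
def gather (x : A) : List A → List (Call A)
  | [] => []
  | n :: l => if h : n ≠ x then ⟨n, x, h⟩ :: gather x l else gather x l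

theorem gather_cons_of_ne {x n : A} (h : n ≠ x) (l : List A) :
    gather x (n :: l) = ⟨n, x, h⟩ :: gather x l := dif_pos h

theorem gather_cons_self (x : A) (l : List A) : gather x (x :: l) = gather x l :=
  dif_neg fun h => h rfl

theorem of_mem_gather {x : A} {l : List A} {c : Call A} (h : c ∈ gather x l) :
    c.y = x ∧ c.x ∈ l := by
  induction l with
  | nil => simp [gather] at h
  | cons n l ih =>
    by_cases hn : n = x
    · subst hn
      rw [gather_cons_self] at h
      exact ⟨(ih h).1, List.mem_cons_of_mem _ (ih h).2⟩
    · rw [gather_cons_of_ne hn] at h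
      rcases List.mem_cons.1 h with rfl | h
      · exact ⟨rfl, List.mem_cons_self⟩
      · exact ⟨(ih h).1, List.mem_cons_of_mem _ (ih h).2⟩

theorem within_gather {R : Finset A} {x : A} {l : List A} (hx : x ∈ R) (hl : ∀ n ∈ l, n ∈ R) :
    Within R (gather x l) := fun c hc =>
  ⟨hl _ (of_mem_gather hc).2, by rw [(of_mem_gather hc).1]; exact hx⟩

theorem not_involves_of_mem_gather {x a : A} {l : List A} (hx : a ≠ x) (ha : a ∉ l) :
    ∀ c ∈ gather x l, ¬ c.involves a := by
  rintro c hc (rfl | rfl)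
  exacts [ha (of_mem_gather hc).2, hx (of_mem_gather hc).1]

theorem subset_applySeq_gather {x n : A} {l : List A} (hn : n ∈ l) (s : A → Finset A) :
    s n ⊆ applySeq (gather x l) s x := by
  induction l generalizing s with
  | nil => simp at hn
  | cons m l ih =>
    by_cases hm : m = x
    · subst hm
      rw [gather_cons_self]
      rcases List.mem_cons.1 hn with rfl | h
      exacts [subset_applySeq _ _ _, ih h s]
    · rw [gather_cons_of_ne hm, applySeq_cons]
      rcases List.mem_cons.1 hn with rfl | h
      · refine subset_trans ?_ (subset_applySeq _ _ _)
        rw [Call.apply_of_involves (Or.inr rfl)]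
        exact Finset.subset_union_left
      · exact (Call.subset_apply _ s n).trans (ih h _)

theorem mem_applySeq_gather {x n : A} {l : List A} (hn : n ∈ l) {s : A → Finset A}
    (hs : n ∈ s n) : n ∈ applySeq (gather x l) s x := subset_applySeq_gather hn s hs

theorem viewFrom_gather_of_mem {x b : A} (hb : b ≠ x) {l : List A} (hl : l.Nodup)
    (hbl : b ∈ l) (s : A → Finset A) :
    viewFrom b s (gather x l) = [(⟨b, x, hb⟩, applySeq (gather x l) s b)] ∧
      s x ⊆ applySeq (gather x l) s b := by
  induction l generalizing s with
  | nil => simp at hbl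
  | cons n l ih =>
    rw [List.nodup_cons] at hl
    rcases List.mem_cons.1 hbl with rfl | h
    · have hno := not_involves_of_mem_gather hb hl.1
      rw [gather_cons_of_ne hb, viewFrom_cons_of (c := ⟨b, x, hb⟩) (Or.inl rfl), viewFrom_eq_nil hno,
        applySeq_cons, applySeq_of_not_involves hno]
      refine ⟨rfl, ?_⟩
      rw [Call.apply_of_involves (c := ⟨b, x, hb⟩) (Or.inl rfl)]
      exact Finset.subset_union_right
    · by_cases hn : n = x
      · subst hn
        rw [gather_cons_self]
        exact ih hl.2 h s
      · have hbn : b ≠ n := by rintro rfl; exact hl.1 h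
        rw [gather_cons_of_ne hn, applySeq_cons,
          viewFrom_cons_of_not (by rintro (h | h); exacts [hbn h, hb h])]
        exact ⟨(ih hl.2 h _).1, (Call.subset_apply _ _ _).trans (ih hl.2 h _).2⟩

/-- Calls leading out of `S` can be dropped without affecting agents who stay within `S`. -/
theorem exists_clean (S : Finset A) (σ : List (Call A)) :
    ∃ σ', (∀ c ∈ σ', c ∈ σ) ∧ Within S σ' ∧ ∀ x, applySeq σ root x ⊆ S →
      viewFrom x root σ' = viewFrom x root σ ∧ applySeq σ' root x = applySeq σ root x := by
  induction σ using List.reverseRecOn with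
  | nil => exact ⟨[], by simp, fun c hc => by simp at hc, fun _ _ => ⟨rfl, rfl⟩⟩
  | append_singleton σ c ih =>
    obtain ⟨σ', hmem, hW, h⟩ := ih
    have hstep : ∀ x, applySeq (σ ++ [c]) root x ⊆ S →
        viewFrom x root σ' = viewFrom x root σ ∧ applySeq σ' root x = applySeq σ root x :=
      fun x hx => h x (by
        rw [applySeq_append] at hx
        exact (subset_applySeq [c] _ x).trans hx)
    by_cases hc : applySeq σ root c.x ∪ applySeq σ root c.y ⊆ S
    · have h1 := h c.x (Finset.subset_union_left.trans hc)
      have h2 := h c.y (Finset.subset_union_right.trans hc)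
      refine ⟨σ' ++ [c], ?_, hW.append ?_, fun x hx => ?_⟩
      · intro d hd
        rcases List.mem_append.1 hd with hd | hd
        · exact List.mem_append_left _ (hmem d hd)
        · exact List.mem_append_right _ hd
      · intro d hd
        obtain rfl := List.mem_singleton.1 hd
        exact ⟨hc (Finset.mem_union_left _ (mem_applySeq_self mem_root_self _ _)),
          hc (Finset.mem_union_right _ (mem_applySeq_self mem_root_self _ _))⟩
      · have hx' := hstep x hx
        have happ : c.apply (applySeq σ' root) x = c.apply (applySeq σ root) x := by
          by_cases hcx : c.involves x
          · rw [Call.apply_of_involves hcx, Call.apply_of_involves hcx, h1.2, h2.2]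
          · rw [Call.apply_of_not_involves hcx, Call.apply_of_not_involves hcx, hx'.2]
        refine ⟨?_, by simpa using happ⟩
        rw [viewFrom_append, viewFrom_append, hx'.1, viewFrom_cons, viewFrom_cons, happ]
        rfl
    · refine ⟨σ', fun d hd => List.mem_append_left _ (hmem d hd), hW, fun x hx => ?_⟩
      have hcx : ¬ c.involves x := by
        intro hcx
        rw [applySeq_append, applySeq_cons, applySeq_nil, Call.apply_of_involves hcx] at hx
        exact hc hx
      rw [viewFrom_append, viewFrom_cons_of_not hcx, applySeq_append, applySeq_cons,
        applySeq_nil, Call.apply_of_not_involves hcx]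
      simpa using hstep x hx

/-- The view that `a` has of an `ab`-free sequence can be realized so that only secrets that `a`
learns are exchanged, with `b` taking part in at most one call. -/
theorem exists_realization {a b : A} (hab : a ≠ b) {s₀ s : A → Finset A}
    (hs₀ : ∀ x, x ∈ s₀ x) (hs : ∀ x, x ∈ s x) (h : s a = s₀ a) (hcl : Closed (s a) s)
    {ρ : List (Call A)} (hρ : ∀ c ∈ ρ, ¬ (c.involves a ∧ c.involves b)) :
    ∃ ρ', viewFrom a s ρ' = viewFrom a s₀ ρ ∧ applySeq ρ' s a = applySeq ρ s₀ a ∧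
      Closed (applySeq ρ' s a) (applySeq ρ' s) ∧ Within (applySeq ρ' s a) ρ' ∧
      (b ∈ s a → ∀ c ∈ ρ', ¬ c.involves b) ∧
      (b ∉ s a → b ∈ applySeq ρ' s a → ∃ (y : A) (hy : b ≠ y), y ≠ a ∧
        y ∈ applySeq ρ' s b ∧ viewFrom b s ρ' = [(⟨b, y, hy⟩, applySeq ρ' s b)]) := by
  induction ρ using List.reverseRecOn with
  | nil =>
    exact ⟨[], rfl, h, hcl, fun c hc => by simp at hc, by simp, fun h1 h2 => absurd h2 h1⟩
  | append_singleton ρ c ih =>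
    obtain ⟨ρ', hv, he, hC, hW, hb1, hb2⟩ := ih fun d hd => hρ d (by simp [hd])
    by_cases hca : c.involves a
    · obtain ⟨x, hxa, hinv, hun⟩ := Call.exists_partner hca
      have hxb : b ≠ x := by
        rintro rfl
        exact hρ c (by simp) ⟨hca, (hinv b).2 (Or.inr rfl)⟩
      set R := applySeq ρ' s a with hR
      set R' := R ∪ applySeq ρ s₀ x with hR'
      have hRR : R ⊆ R' := Finset.subset_union_left
      have hxR' : x ∈ R' := Finset.mem_union_right _ (mem_applySeq_self hs₀ _ _)
      have haR : a ∈ R := mem_applySeq_self hs _ _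
      set N := (R' \ R).erase x with hN
      have hNR' : ∀ n ∈ N.toList, n ∈ R' := by
        intro n hn
        simp only [hN, Finset.mem_toList, Finset.mem_erase, Finset.mem_sdiff] at hn
        exact hn.2.1
      have haN : a ∉ N.toList := by simp [hN, haR]
      have hWg : Within R' (gather x N.toList) := within_gather hxR' hNR'
      have hWc : Within R' [c] := by
        intro d hd
        obtain rfl := List.mem_singleton.1 hd
        constructor
        · rcases (hinv d.x).1 (Or.inl rfl) with h | h <;> rw [h]
          exacts [hRR haR, hxR']
        · rcases (hinv d.y).1 (Or.inr rfl) with h | h <;> rw [h]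
          exacts [hRR haR, hxR']
      set u := applySeq (gather x N.toList) (applySeq ρ' s) with hu
      have hCu : Closed R' u := (hC.mono hRR).applySeq hWg
      have hua : u a = R := applySeq_of_not_involves (not_involves_of_mem_gather hxa.symm haN) _
      have hcu : c.apply u a = R' := by
        rw [Call.apply_of_involves hca, hun, hua]
        refine subset_antisymm (Finset.union_subset hRR (hCu.1 x hxR')) fun z hz => ?_
        by_cases hzR : z ∈ R
        · exact Finset.mem_union_left _ hzR
        · refine Finset.mem_union_right _ ?_
          by_cases hzx : z = x
          · subst hzx
            exact mem_applySeq_self (mem_applySeq_self hs _) _ _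
          · exact mem_applySeq_gather (by simp [hN, hzx, hz, hzR]) (mem_applySeq_self hs _ _)
      have hct : c.apply (applySeq ρ s₀) a = R' := by
        rw [Call.apply_of_involves hca, hun, ← he]
      have hfin : applySeq (ρ' ++ (gather x N.toList ++ [c])) s a = R' := by
        rw [applySeq_append, applySeq_append, applySeq_cons, applySeq_nil, hcu]
      have hcb : ¬ c.involves b := by
        rw [hinv]; rintro (h | h)
        exacts [hab h.symm, hxb h]
      refine ⟨ρ' ++ (gather x N.toList ++ [c]), ?_, ?_, ?_, ?_, ?_, ?_⟩
      · rw [viewFrom_append, viewFrom_append, viewFrom_append, hv,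
          viewFrom_eq_nil (not_involves_of_mem_gather hxa.symm haN), viewFrom_cons_of hca,
          viewFrom_cons_of hca, hcu, hct]
        rfl
      · rw [hfin, applySeq_append, applySeq_cons, applySeq_nil, hct]
      · rw [hfin, applySeq_append]
        exact (hC.mono hRR).applySeq (hWg.append hWc)
      · rw [hfin]
        exact Within.append (fun d hd => ⟨hRR (hW d hd).1, hRR (hW d hd).2⟩) (hWg.append hWc)
      · intro hbs d hd
        have hbR : b ∈ R := subset_applySeq _ _ _ hbs
        have hbN : b ∉ N.toList := by simp [hN, hbR]
        simp only [List.mem_append, List.mem_singleton] at hd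
        rcases hd with hd | hd | rfl
        exacts [hb1 hbs d hd, not_involves_of_mem_gather hxb hbN d hd, hcb]
      · intro hbs hbR'
        rw [hfin] at hbR'
        have hsuf : applySeq (ρ' ++ (gather x N.toList ++ [c])) s b = u b := by
          rw [applySeq_append, applySeq_append, applySeq_cons, applySeq_nil,
            Call.apply_of_not_involves hcb]
        rw [hsuf, viewFrom_append, viewFrom_append, viewFrom_cons_of_not hcb]
        by_cases hbR : b ∈ R
        · have hbN : b ∉ N.toList := by simp [hN, hbR]
          have hno := not_involves_of_mem_gather hxb hbN
          rw [viewFrom_eq_nil hno, hu, applySeq_of_not_involves hno]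
          simpa using hb2 hbs hbR
        · have hbN : b ∈ N.toList := by simp [hN, hbR, hbR', hxb]
          have hno : ∀ d ∈ ρ', ¬ d.involves b := fun d hd hdb => hbR (hW.mem_of_involves hd hdb)
          have hg := viewFrom_gather_of_mem hxb (Finset.nodup_toList N) hbN (applySeq ρ' s)
          refine ⟨x, hxb, hxa, hg.2 (mem_applySeq_self hs _ _), ?_⟩
          rw [viewFrom_eq_nil hno, hg.1]
          rfl
    · refine ⟨ρ', ?_, ?_, hC, hW, hb1, hb2⟩
      · rw [viewFrom_append, viewFrom_cons_of_not hca, hv]; simp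
      · rw [applySeq_append, applySeq_cons, applySeq_nil, Call.apply_of_not_involves hca, he]

end Closed

section Connected

theorem GEquiv.append_call_of_union {a b p : A} (hab : a ≠ b) {c : Call A}
    (hca : c.involves a) (hcb : c.involves b) (hp : p ∈ ({a, b} : Finset A))
    {σ τ : List (Call A)} (h : viewFrom p root σ = viewFrom p root τ)
    (hS : applySeq σ root a ∪ applySeq σ root b = applySeq τ root a ∪ applySeq τ root b) :
    GEquiv {a, b} (σ ++ [c]) (τ ++ [c]) := by
  have hcp : c.involves p := by
    rcases Finset.mem_insert.1 hp with rfl | hp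
    · exact hca
    · rw [Finset.mem_singleton.1 hp]; exact hcb
  refine .append_call hp hcp h ?_
  rw [Call.apply_of_involves hcp, Call.apply_of_involves hcp,
    Call.union_eq_of_involves hab hca hcb, Call.union_eq_of_involves hab hca hcb, hS]

theorem Closed.union_eq {S : Finset A} {s : A → Finset A} (h : Closed S s) {a b : A}
    (ha : a ∈ S) (hb : b ∈ S) (hS : S ⊆ s a ∪ s b) : s a ∪ s b = S :=
  (Finset.union_subset (h.1 a ha) (h.1 b hb)).antisymm hS

theorem Closed.eq_of_subset {S : Finset A} {s : A → Finset A} (h : Closed S s) {b : A}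
    (hb : b ∈ S) (hS : S ⊆ s b) : s b = S := (h.1 b hb).antisymm hS

theorem viewFrom_singleton {c : Call A} {b : A} (h : c.involves b) (s : A → Finset A) :
    viewFrom b s [c] = [(c, c.apply s b)] := viewFrom_cons_of h s []

theorem viewFrom_singleton_of_not {c : Call A} {b : A} (h : ¬ c.involves b)
    (s : A → Finset A) : viewFrom b s [c] = [] := viewFrom_cons_of_not h s []

theorem Call.not_involves_mk {x y a : A} (h : x ≠ y) (hx : a ≠ x) (hy : a ≠ y) :
    ¬ (⟨x, y, h⟩ : Call A).involves a := by
  rintro (h | h)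
  exacts [hx h, hy h]

theorem Call.involves_left {x y : A} (h : x ≠ y) : (⟨x, y, h⟩ : Call A).involves x := Or.inl rfl

theorem Call.involves_right {x y : A} (h : x ≠ y) : (⟨x, y, h⟩ : Call A).involves y := Or.inr rfl

theorem Call.apply_left {x y : A} (h : x ≠ y) (s : A → Finset A) :
    (⟨x, y, h⟩ : Call A).apply s x = s x ∪ s y := Call.apply_of_involves (involves_left h) s

/-- The agents of `D` call `x`, who is then called by `b`. -/
def collect (b x : A) (h : b ≠ x) (D : List A) : List (Call A) := gather x D ++ [⟨b, x, h⟩]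

theorem not_involves_of_mem_collect {a b x : A} (hbx : b ≠ x) {D : List A} (hab : a ≠ b)
    (hax : a ≠ x) (haD : a ∉ D) : ∀ c ∈ collect b x hbx D, ¬ c.involves a := by
  intro c hc
  rcases List.mem_append.1 hc with hc | hc
  · exact not_involves_of_mem_gather hax haD c hc
  · rw [List.mem_singleton.1 hc]
    exact Call.not_involves_mk _ hab hax

theorem within_collect {b x : A} (hbx : b ≠ x) {D : List A} {S : Finset A} (hbS : b ∈ S)
    (hxS : x ∈ S) (hDS : ∀ n ∈ D, n ∈ S) : Within S (collect b x hbx D) :=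
  (within_gather hxS hDS).append (.singleton _ hbS hxS)

theorem applySeq_collect {b x : A} (hbx : b ≠ x) {D : List A} {S : Finset A} (hbD : b ∉ D)
    (hbS : b ∈ S) (hxS : x ∈ S) (hDS : ∀ n ∈ D, n ∈ S) {s : A → Finset A} (hC : Closed S s)
    (h : ∀ z ∈ S, z ∈ s b ∨ ∃ n ∈ x :: D, z ∈ s n) :
    Closed S (applySeq (collect b x hbx D) s) ∧ applySeq (collect b x hbx D) s b = S ∧
      applySeq (collect b x hbx D) s x = S ∧
      viewFrom b s (collect b x hbx D) = [(⟨b, x, hbx⟩, S)] := by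
  have hC' := hC.applySeq (within_collect hbx hbS hxS hDS)
  have hb : applySeq (collect b x hbx D) s b = S := by
    refine hC'.eq_of_subset hbS fun z hz => ?_
    rw [collect, applySeq_append, applySeq_cons, applySeq_nil, Call.apply_left]
    rcases h z hz with hz | ⟨n, hn, hz⟩
    · exact Finset.mem_union_left _ (subset_applySeq _ _ _ hz)
    · refine Finset.mem_union_right _ ?_
      rcases List.mem_cons.1 hn with rfl | hn
      exacts [subset_applySeq _ _ _ hz, subset_applySeq_gather hn s hz]
  have hcall : (⟨b, x, hbx⟩ : Call A).apply (applySeq (gather x D) s) b = S := by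
    rw [← hb, collect, applySeq_append]; rfl
  refine ⟨hC', hb, ?_, ?_⟩
  · rw [collect, applySeq_append, applySeq_cons, applySeq_nil,
      Call.apply_of_involves (Call.involves_right _),
      ← Call.apply_of_involves (Call.involves_left _), hcall]
  · rw [collect, viewFrom_append, viewFrom_eq_nil (not_involves_of_mem_gather hbx hbD),
      viewFrom_singleton (Call.involves_left _), hcall]
    rfl

/-- Between two calls `ab`, any exchange of information may be replaced by `b` collecting the
new secrets directly. -/
theorem gEquiv_gather {a b : A} (hab : a ≠ b) {c : Call A} (hca : c.involves a)
    (hcb : c.involves b) {π ρ κ : List (Call A)} {S T : Finset A}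
    (hρ : ∀ d ∈ ρ, ¬ (d.involves a ∧ d.involves b))
    (hva : viewFrom a root κ = viewFrom a root π)
    (hTa : applySeq κ root a = T) (hTb : applySeq κ root b = T)
    (hT : Closed T (applySeq κ root))
    (hS : applySeq (π ++ ρ) root a ∪ applySeq (π ++ ρ) root b = S) :
    GEquiv {a, b} (π ++ ρ ++ [c]) (κ ++ gather b (S \ T).toList ++ [c]) := by
  have hπa : applySeq κ root a = applySeq π root a := applySeq_eq_of_viewFrom_eq hva rfl
  obtain ⟨ρ', hv, he, hC, hW, hb, -⟩ := exists_realization hab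
    (mem_applySeq_self mem_root_self π) (mem_applySeq_self mem_root_self κ) hπa
    (by rw [hTa]; exact hT) hρ
  rw [← applySeq_append π ρ] at he
  have haT : a ∈ T := hTa ▸ mem_applySeq_self mem_root_self κ a
  have hbT : b ∈ T := hTb ▸ mem_applySeq_self mem_root_self κ b
  have hb := hb (by rw [hTa]; exact hbT)
  have hRS : applySeq ρ' (applySeq κ root) a ⊆ S := by
    rw [he, ← hS]; exact Finset.subset_union_left
  have hTR : T ⊆ applySeq ρ' (applySeq κ root) a := by
    have := subset_applySeq ρ' (applySeq κ root) a
    rwa [hTa] at this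
  have hTS : T ⊆ S := hTR.trans hRS
  have hv' : viewFrom a root (π ++ ρ) = viewFrom a root (κ ++ ρ') := by
    rw [viewFrom_append, viewFrom_append, hv, hva]
  have hb2 : applySeq (κ ++ ρ') root b = T := by
    rw [applySeq_append, applySeq_of_not_involves hb, hTb]
  have haS : a ∈ S := hTS haT
  have hbS : b ∈ S := hTS hbT
  have hbD : b ∉ (S \ T).toList := by simp [hbT]
  have haD : a ∉ (S \ T).toList := by simp [haT]
  have hDS : ∀ n ∈ (S \ T).toList, n ∈ S := by simp +contextual
  rcases (S \ T).eq_empty_or_nonempty with hD | ⟨x, hx⟩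
  · have hST : S = T := (Finset.sdiff_eq_empty_iff_subset.1 hD).antisymm hTS
    have hR : applySeq (κ ++ ρ') root a = T := by
      rw [applySeq_append]
      exact (hST ▸ hRS).antisymm hTR
    have h1 : GEquiv {a, b} (π ++ ρ ++ [c]) (κ ++ ρ' ++ [c]) :=
      .append_call_of_union hab hca hcb (by simp) hv' (by rw [hS, hR, hb2, hST]; simp)
    have h2 : GEquiv {a, b} (κ ++ ρ' ++ [c]) (κ ++ [c]) :=
      .append_call_of_union hab hca hcb (p := b) (by simp)
        (by rw [viewFrom_append, viewFrom_eq_nil hb, List.append_nil])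
        (by rw [hR, hb2, hTa, hTb])
    have : gather b (S \ T).toList = [] := by rw [hD]; simp [gather]
    rw [this, List.append_nil]
    exact h1.trans h2
  · have hxS : x ∈ S := (Finset.mem_sdiff.1 hx).1
    have hxT : x ∉ T := (Finset.mem_sdiff.1 hx).2
    have hax : a ≠ x := by rintro rfl; exact hxT haT
    have hbx : b ≠ x := by rintro rfl; exact hxT hbT
    set D := (S \ T).toList with hDdef
    set m := collect b x hbx D with hm
    have hma : ∀ d ∈ m, ¬ d.involves a := not_involves_of_mem_collect hbx hab hax haD
    have key : ∀ s : A → Finset A, (∀ z, z ∈ s z) → s b = T → Closed S s →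
        Closed S (applySeq m s) ∧ applySeq m s b = S ∧
          viewFrom b s m = [(⟨b, x, hbx⟩, S)] := by
      intro s hs hsb hsC
      obtain ⟨h1, h2, -, h3⟩ := applySeq_collect hbx hbD hbS hxS hDS hsC fun z hz => by
        by_cases hzT : z ∈ T
        · left; rw [hsb]; exact hzT
        · exact Or.inr ⟨z, by simp [hDdef, hz, hzT], hs z⟩
      exact ⟨h1, h2, h3⟩
    obtain ⟨k1, k2, k3⟩ := key (applySeq (κ ++ ρ') root) (mem_applySeq_self mem_root_self _) hb2
      (by rw [applySeq_append]; exact hC.mono hRS)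
    obtain ⟨l1, l2, l3⟩ := key (applySeq κ root) (mem_applySeq_self mem_root_self _) hTb
      (hT.mono hTS)
    rw [← applySeq_append] at k1 k2 l1 l2
    have hu1 := k1.union_eq haS hbS (by rw [k2]; exact Finset.subset_union_right)
    have hu2 := l1.union_eq haS hbS (by rw [l2]; exact Finset.subset_union_right)
    have hgW : Within S (gather b D) := within_gather hbS hDS
    have hga' := not_involves_of_mem_gather hab haD
    have hu3 : applySeq (κ ++ gather b D) root a ∪ applySeq (κ ++ gather b D) root b = S := by
      refine Closed.union_eq ?_ haS hbS fun z hz => Finset.mem_union_right _ ?_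
      · rw [applySeq_append]; exact (hT.mono hTS).applySeq hgW
      · rw [applySeq_append]
        by_cases hzT : z ∈ T
        · refine subset_applySeq _ _ _ ?_
          rw [hTb]; exact hzT
        · exact mem_applySeq_gather (by simp [hDdef, hz, hzT])
            (mem_applySeq_self mem_root_self κ z)
    have h1 : GEquiv {a, b} (π ++ ρ ++ [c]) (κ ++ ρ' ++ m ++ [c]) :=
      .append_call_of_union hab hca hcb (p := a) (by simp)
        (by rw [hv', viewFrom_append _ _ _ m, viewFrom_eq_nil hma, List.append_nil])
        (by rw [hS, hu1])
    have h2 : GEquiv {a, b} (κ ++ ρ' ++ m ++ [c]) (κ ++ m ++ [c]) :=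
      .append_call_of_union hab hca hcb (p := b) (by simp)
        (by rw [viewFrom_append _ _ _ m, viewFrom_append _ _ _ m, k3, l3, viewFrom_append,
          viewFrom_eq_nil hb, List.append_nil])
        (by rw [hu1, hu2])
    have h3 : GEquiv {a, b} (κ ++ m ++ [c]) (κ ++ gather b D ++ [c]) :=
      .append_call_of_union hab hca hcb (p := a) (by simp)
        (by rw [viewFrom_append _ _ _ m, viewFrom_append _ _ _ (gather b D),
          viewFrom_eq_nil hma, viewFrom_eq_nil hga'])
        (by rw [hu2, hu3])
    exact (h1.trans h2).trans h3

theorem exists_closed_after_call {a b : A} {e : Call A} (ha : e.involves a)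
    (hb : e.involves b) (σ : List (Call A)) :
    ∃ κ, viewFrom a root κ = viewFrom a root (σ ++ [e]) ∧
      viewFrom b root κ = viewFrom b root (σ ++ [e]) ∧
      applySeq κ root a = applySeq (σ ++ [e]) root a ∧
      applySeq κ root b = applySeq (σ ++ [e]) root a ∧
      Closed (applySeq (σ ++ [e]) root a) (applySeq κ root) := by
  obtain ⟨κ, -, hW, h⟩ := exists_clean (applySeq (σ ++ [e]) root a) (σ ++ [e])
  have hba : applySeq (σ ++ [e]) root b = applySeq (σ ++ [e]) root a := by
    simp only [applySeq_append, applySeq_cons, applySeq_nil]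
    rw [Call.apply_of_involves ha, Call.apply_of_involves hb]
  have h1 := h a subset_rfl
  have h2 := h b (by rw [hba])
  exact ⟨κ, h1.1, h2.1, h1.2, h2.2.trans hba, (closed_root _).applySeq hW⟩

/-- The structure of the sequences that are `{a, b}`-equivalent to a sequence whose last call
`ab` is `e`. -/
theorem exists_split_of_gEquiv {a b : A} {e : Call A} (ha : e.involves a) (hb : e.involves b)
    {σ₀ ρ τ : List (Call A)} (hρ : ∀ c ∈ ρ, ¬ (c.involves a ∧ c.involves b))
    (h : GEquiv {a, b} (σ₀ ++ e :: ρ) τ) :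
    ∃ τ₀ ρ', τ = τ₀ ++ e :: ρ' ∧ (∀ c ∈ ρ', ¬ (c.involves a ∧ c.involves b)) ∧
      GEquiv {a, b} σ₀ τ₀ ∧
      Relation.ReflTransGen (fun π π' : List (Call A) => ∃ p ∈ ({a, b} : Finset A),
        viewFrom p root (π ++ [e]) = viewFrom p root (π' ++ [e])) σ₀ τ₀ := by
  induction h with
  | refl => exact ⟨σ₀, ρ, rfl, hρ, .refl, .refl⟩
  | tail _ hstep ih =>
    obtain ⟨τ₀, ρ₁, rfl, hρ₁, h1, h2⟩ := ih
    obtain ⟨p, hp, hp'⟩ := hstep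
    rw [Finset.mem_insert, Finset.mem_singleton] at hp
    rcases hp with rfl | rfl
    · obtain ⟨υ₀, ρ₂, rfl, hρ₂, h3, h4⟩ := exists_split_of_agEquiv ha hρ₁ hp'
      exact ⟨υ₀, ρ₂, rfl, hρ₂, h1.trans (.of_viewFrom_eq (by simp) h3),
        h2.tail ⟨p, by simp, h4⟩⟩
    · obtain ⟨υ₀, ρ₂, rfl, hρ₂, h3, h4⟩ := exists_split_of_agEquiv (b := a) hb
        (fun c hc => fun h => hρ₁ c hc h.symm) hp'
      exact ⟨υ₀, ρ₂, rfl, fun c hc => fun h => hρ₂ c hc h.symm,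
        h1.trans (.of_viewFrom_eq (by simp) h3), h2.tail ⟨p, by simp, h4⟩⟩

theorem applySeq_eq_of_viewFrom_eq_of_call {a b p : A} {e : Call A} (ha : e.involves a)
    (hb : e.involves b) (hp : p ∈ ({a, b} : Finset A)) {σ τ : List (Call A)}
    (h : viewFrom p root (σ ++ [e]) = viewFrom p root (τ ++ [e])) :
    applySeq (σ ++ [e]) root a = applySeq (τ ++ [e]) root a := by
  have h' := applySeq_eq_of_viewFrom_eq h rfl
  have hep : e.involves p := by
    rcases Finset.mem_insert.1 hp with rfl | hp
    · exact ha
    · rw [Finset.mem_singleton.1 hp]; exact hb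
  simp only [applySeq_append, applySeq_cons, applySeq_nil] at h' ⊢
  rwa [Call.apply_of_involves hep, Call.apply_of_involves hep, ← Call.apply_of_involves ha,
    ← Call.apply_of_involves ha] at h'

theorem gEquiv_gather_of_viewFrom_eq {a b p : A} (hab : a ≠ b) {c : Call A}
    (hca : c.involves a) (hcb : c.involves b) (hp : p ∈ ({a, b} : Finset A))
    {κ κ' : List (Call A)} {T D : Finset A} (hD : Disjoint D T)
    (hv : viewFrom p root κ = viewFrom p root κ')
    (h1 : applySeq κ root a = T) (h2 : applySeq κ root b = T) (h3 : Closed T (applySeq κ root))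
    (h1' : applySeq κ' root a = T) (h2' : applySeq κ' root b = T)
    (h3' : Closed T (applySeq κ' root)) :
    GEquiv {a, b} (κ ++ gather b D.toList ++ [c]) (κ' ++ gather b D.toList ++ [c]) := by
  have hst : ∀ x ∈ insert a (insert b D), applySeq κ root x = applySeq κ' root x := by
    intro x hx
    simp only [Finset.mem_insert] at hx
    rcases hx with rfl | rfl | hx
    · rw [h1, h1']
    · rw [h2, h2']
    · have hxT := Finset.disjoint_left.1 hD hx
      rw [h3.2 x hxT, h3'.2 x hxT]
  have hW : Within (insert a (insert b D)) (gather b D.toList) :=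
    within_gather (by simp) (by simp +contextual)
  have hq : ∀ q ∈ insert a (insert b D), applySeq (κ ++ gather b D.toList) root q =
      applySeq (κ' ++ gather b D.toList) root q := by
    intro q hq
    rw [applySeq_append, applySeq_append]
    exact applySeq_eq_of_viewFrom_eq (viewFrom_congr q hW hst) (hst q hq)
  refine .append_call_of_union hab hca hcb hp ?_ ?_
  · rw [viewFrom_append, viewFrom_append, hv, viewFrom_congr p hW hst]
  · rw [hq a (by simp), hq b (by simp)]

/-- After the first call `ab`, equivalence is preserved by a further call `ab` as soon as the
two sequences pool the same secrets. -/
theorem gEquiv_append_call_of_occurs {a b : A} (hab : a ≠ b) {c e : Call A}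
    (hca : c.involves a) (hcb : c.involves b) (hea : e.involves a) (heb : e.involves b)
    {σ₀ ρ τ : List (Call A)} (hρ : ∀ d ∈ ρ, ¬ (d.involves a ∧ d.involves b))
    (h : GEquiv {a, b} (σ₀ ++ e :: ρ) τ)
    (hS : applySeq (σ₀ ++ e :: ρ) root a ∪ applySeq (σ₀ ++ e :: ρ) root b =
      applySeq τ root a ∪ applySeq τ root b) :
    GEquiv {a, b} (σ₀ ++ e :: ρ ++ [c]) (τ ++ [c]) := by
  obtain ⟨τ₀, ρ', rfl, hρ', -, hlink⟩ := exists_split_of_gEquiv hea heb hρ h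
  obtain ⟨κ, ha, hb, hTa, hTb, hC⟩ := exists_closed_after_call hea heb σ₀
  set T := applySeq (σ₀ ++ [e]) root a with hT
  have key : applySeq (τ₀ ++ [e]) root a = T ∧ ∃ κ',
      viewFrom a root κ' = viewFrom a root (τ₀ ++ [e]) ∧
      viewFrom b root κ' = viewFrom b root (τ₀ ++ [e]) ∧
      applySeq κ' root a = T ∧ applySeq κ' root b = T ∧ Closed T (applySeq κ' root) ∧
      ∀ D : Finset A, Disjoint D T →
        GEquiv {a, b} (κ ++ gather b D.toList ++ [c]) (κ' ++ gather b D.toList ++ [c]) := by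
    clear h hS
    induction hlink with
    | refl => exact ⟨rfl, κ, ha, hb, hTa, hTb, hC, fun _ _ => .refl⟩
    | @tail υ υ' _ hstep ih =>
      obtain ⟨hT', κ', ha', hb', hTa', hTb', hC', hD'⟩ := ih
      obtain ⟨p, hp, hv⟩ := hstep
      have hT'' : applySeq (υ' ++ [e]) root a = T :=
        (applySeq_eq_of_viewFrom_eq_of_call hea heb hp hv).symm.trans hT'
      obtain ⟨μ, ha2, hb2, hTa2, hTb2, hC2⟩ := exists_closed_after_call hea heb υ'
      rw [hT''] at hTa2 hTb2 hC2
      refine ⟨hT'', μ, ha2, hb2, hTa2, hTb2, hC2, fun D hD => (hD' D hD).trans ?_⟩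
      refine gEquiv_gather_of_viewFrom_eq hab hca hcb hp hD ?_ hTa' hTb' hC' hTa2 hTb2 hC2
      rw [Finset.mem_insert, Finset.mem_singleton] at hp
      rcases hp with rfl | rfl
      · rw [ha', ha2, hv]
      · rw [hb', hb2, hv]
  obtain ⟨-, κ', ha', -, hTa', hTb', hC', hD'⟩ := key
  have e1 : ∀ (l m : List (Call A)), l ++ e :: m = l ++ [e] ++ m := by simp
  rw [e1 σ₀, e1 τ₀] at hS ⊢
  refine (gEquiv_gather hab hca hcb hρ ha hTa hTb hC hS).trans ?_
  exact (hD' _ Finset.sdiff_disjoint).trans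
    (gEquiv_gather hab hca hcb hρ' ha' hTa' hTb' hC' rfl).symm

end Connected

section FirstCall

/-- `S` consists of `a`, `b` and the set `D` of the other agents. -/
structure Pool (a b : A) (D S : Finset A) : Prop where
  ne : a ≠ b
  left_notMem : a ∉ D
  right_notMem : b ∉ D
  mem_iff : ∀ z, z ∈ S ↔ z = a ∨ z = b ∨ z ∈ D

theorem Pool.symm {a b : A} {D S : Finset A} (h : Pool a b D S) : Pool b a D S :=
  ⟨h.ne.symm, h.right_notMem, h.left_notMem, fun z => by rw [h.mem_iff, or_left_comm]⟩

theorem Pool.left_mem {a b : A} {D S : Finset A} (h : Pool a b D S) : a ∈ S :=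
  (h.mem_iff a).2 (Or.inl rfl)

theorem Pool.left_ne {a b x : A} {D S : Finset A} (h : Pool a b D S) (hx : x ∈ D) : a ≠ x := by
  rintro rfl; exact h.left_notMem hx

theorem Pool.mem_of_mem {a b x : A} {D S : Finset A} (h : Pool a b D S) (hx : x ∈ D) : x ∈ S :=
  (h.mem_iff x).2 (Or.inr (Or.inr hx))

theorem Pool.toList_subset {a b : A} {D S : Finset A} (h : Pool a b D S) :
    ∀ n ∈ D.toList, n ∈ S := fun _ hn => h.mem_of_mem (Finset.mem_toList.1 hn)

/-- Agents `a` and `b` together know exactly `S` after `σ`. -/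
def Pools (a b : A) (S : Finset A) (σ : List (Call A)) : Prop :=
  applySeq σ root a ∪ applySeq σ root b = S

theorem Pools.symm {a b : A} {S : Finset A} {σ : List (Call A)} (h : Pools a b S σ) :
    Pools b a S σ := (Finset.union_comm _ _).trans h

theorem Pools.left_subset {a b : A} {S : Finset A} {σ : List (Call A)} (h : Pools a b S σ) :
    applySeq σ root a ⊆ S := Finset.subset_union_left.trans_eq h

theorem pools_of_closed {a b : A} {D S : Finset A} (h : Pool a b D S) {σ : List (Call A)}
    (hC : Closed S (applySeq σ root)) (hb : applySeq σ root b = S) : Pools a b S σ :=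
  hC.union_eq h.left_mem h.symm.left_mem (by rw [hb]; exact Finset.subset_union_right)

/-- Agent `b` takes part in a single call, with an agent of `D`, learning all of `S`. -/
def LearnsAtOnce (b : A) (D S : Finset A) (σ : List (Call A)) : Prop :=
  ∃ (x : A) (h : b ≠ x), x ∈ D ∧ viewFrom b root σ = [(⟨b, x, h⟩, S)]

variable {a b : A} {D S : Finset A} {c : Call A}

theorem Pools.gEquiv_left (hP : Pool a b D S) (hca : c.involves a) (hcb : c.involves b)
    {σ τ : List (Call A)} (hσ : Pools a b S σ) (hτ : Pools a b S τ)
    (h : viewFrom a root σ = viewFrom a root τ) : GEquiv {a, b} (σ ++ [c]) (τ ++ [c]) :=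
  .append_call_of_union hP.ne hca hcb (p := a) (by simp) h (Eq.trans hσ (Eq.symm hτ))

theorem Pools.gEquiv_right (hP : Pool a b D S) (hca : c.involves a) (hcb : c.involves b)
    {σ τ : List (Call A)} (hσ : Pools a b S σ) (hτ : Pools a b S τ)
    (h : viewFrom b root σ = viewFrom b root τ) : GEquiv {a, b} (σ ++ [c]) (τ ++ [c]) :=
  .append_call_of_union hP.ne hca hcb (p := b) (by simp) h (Eq.trans hσ (Eq.symm hτ))

theorem exists_relay (hP : Pool a b D S) {x y : A} (hx : x ∈ D) (hy : y ∈ D) :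
    ∃ σ, Pools a b S σ ∧ viewFrom a root σ = [(⟨a, y, hP.left_ne hy⟩, {a, y})] ∧
      viewFrom b root σ = [(⟨b, x, hP.symm.left_ne hx⟩, S)] := by
  have hay := hP.left_ne hy
  have hbx := hP.symm.left_ne hx
  have hCa : Closed S ((⟨a, y, hay⟩ : Call A).apply root) :=
    (closed_root S).apply hP.left_mem (hP.mem_of_mem hy)
  obtain ⟨h1, h2, -, h3⟩ := applySeq_collect hbx (D := D.toList) (by simp [hP.right_notMem])
    hP.symm.left_mem (hP.mem_of_mem hx) hP.toList_subset hCa fun z hz => by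
      rcases (hP.mem_iff z).1 hz with rfl | rfl | hz
      · refine Or.inr ⟨y, by simp [hy], ?_⟩
        rw [Call.apply_of_involves (Call.involves_right _)]
        exact Finset.mem_union_left _ (mem_root_self _)
      · exact Or.inl (Call.subset_apply _ _ _ (mem_root_self _))
      · exact Or.inr ⟨z, by simp [hz], Call.subset_apply _ _ _ (mem_root_self _)⟩
  refine ⟨⟨a, y, hay⟩ :: collect b x hbx D.toList, pools_of_closed hP h1 h2, ?_, ?_⟩
  · rw [viewFrom_cons_of (Call.involves_left _), viewFrom_eq_nil
      (not_involves_of_mem_collect hbx hP.ne (hP.left_ne hx) (by simp [hP.left_notMem])),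
      Call.apply_left]
    rfl
  · rw [viewFrom_cons_of_not (Call.not_involves_mk _ hP.ne.symm (hP.symm.left_ne hy)), h3]

theorem LearnsAtOnce.gEquiv_same (hP : Pool a b D S) (hca : c.involves a)
    (hcb : c.involves b) {σ τ : List (Call A)} (hσ : Pools a b S σ) (hτ : Pools a b S τ)
    (h : LearnsAtOnce b D S σ) (h' : LearnsAtOnce b D S τ) :
    GEquiv {a, b} (σ ++ [c]) (τ ++ [c]) := by
  obtain ⟨x, hbx, hx, hv⟩ := h
  obtain ⟨x', hbx', hx', hv'⟩ := h'
  obtain ⟨μ, hμ, h1, h2⟩ := exists_relay hP hx hx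
  obtain ⟨ν, hν, h3, h4⟩ := exists_relay hP hx' hx
  exact ((hσ.gEquiv_right hP hca hcb hμ (hv.trans h2.symm)).trans
    (hμ.gEquiv_left hP hca hcb hν (h1.trans h3.symm))).trans
    (hν.gEquiv_right hP hca hcb hτ (h4.trans hv'.symm))

theorem LearnsAtOnce.gEquiv_swap (hP : Pool a b D S) (hD : 1 < D.card) (hca : c.involves a)
    (hcb : c.involves b) {σ τ : List (Call A)} (hσ : Pools a b S σ) (hτ : Pools a b S τ)
    (h : LearnsAtOnce b D S σ) (h' : LearnsAtOnce a D S τ) :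
    GEquiv {a, b} (σ ++ [c]) (τ ++ [c]) := by
  obtain ⟨y, hy, z, hz, hyz⟩ := Finset.one_lt_card.1 hD
  have hay := hP.left_ne hy
  have haz := hP.left_ne hz
  have hby := hP.symm.left_ne hy
  have hbz := hP.symm.left_ne hz
  set S' := insert b (D.erase y) with hS'
  have hS'S : S' ⊆ S := by
    intro n hn
    simp only [hS', Finset.mem_insert, Finset.mem_erase] at hn
    exact (hP.mem_iff n).2 (Or.inr (hn.imp_right And.right))
  have hzS' : z ∈ S' := by simp [hS', hz, hyz.symm]
  have hbS' : b ∈ S' := by simp [hS']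
  have hES' : ∀ n ∈ (D.erase y).toList, n ∈ S' := by simp +contextual [hS']
  set l := collect b z hbz (D.erase y).toList with hl
  have hla : ∀ d ∈ l, ¬ d.involves a :=
    not_involves_of_mem_collect hbz hP.ne haz (by simp [hP.left_notMem])
  have hlW : Within S' l := within_collect hbz hbS' hzS' hES'
  obtain ⟨h1, h2, h3, h4⟩ := applySeq_collect hbz (D := (D.erase y).toList)
    (by simp [hP.right_notMem]) hbS' hzS' hES' (closed_root S') fun n hn => by
      rcases Finset.mem_insert.1 hn with rfl | hn
      · exact Or.inl (mem_root_self _)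
      · exact Or.inr ⟨n, List.mem_cons_of_mem _ (Finset.mem_toList.2 hn), mem_root_self _⟩
  rw [← hl] at h1 h2 h3 h4
  have hagree : ∀ x ∈ S', (⟨a, y, hay⟩ : Call A).apply root x = root x := by
    intro x hx
    refine Call.apply_of_not_involves (Call.not_involves_mk _ ?_ ?_) _
    · rintro rfl
      simp [hS', hP.ne, hP.left_notMem] at hx
    · rintro rfl
      simp [hS', hby.symm] at hx
  have hμb : viewFrom b root (⟨a, y, hay⟩ :: l) = viewFrom b root l := by
    rw [viewFrom_cons_of_not (Call.not_involves_mk _ hP.ne.symm hby),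
      viewFrom_congr b hlW hagree]
  have hμa : viewFrom a root (⟨a, y, hay⟩ :: l) = [(⟨a, y, hay⟩, {a, y})] := by
    rw [viewFrom_cons_of (Call.involves_left _), viewFrom_eq_nil hla, Call.apply_left]
    rfl
  have hμ : Pools a b S (⟨a, y, hay⟩ :: l) := by
    have e1 : applySeq (⟨a, y, hay⟩ :: l) root a = {a, y} := by
      rw [applySeq_eq_foldl_viewFrom, hμa]; rfl
    rw [Pools, e1, applySeq_eq_of_viewFrom_eq hμb rfl, h2]
    ext n
    simp only [hS', Finset.mem_union, Finset.mem_insert, Finset.mem_singleton,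
      Finset.mem_erase, hP.mem_iff]
    by_cases hn : n = y
    · subst hn; simp [hy]
    · simp [hn]
  obtain ⟨k1, k2, -, k4⟩ := applySeq_collect haz (D := [y]) (by simpa using hay) hP.left_mem
    (hP.mem_of_mem hz) (by simpa using hP.mem_of_mem hy) (h1.mono hS'S) fun n hn => by
      by_cases hny : n = y
      · subst hny
        exact Or.inr ⟨n, by simp, mem_applySeq_self mem_root_self _ _⟩
      · rcases (hP.mem_iff n).1 hn with rfl | hn
        · exact Or.inl (mem_applySeq_self mem_root_self _ _)
        · refine Or.inr ⟨z, by simp, ?_⟩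
          rw [h3]
          simpa [hS', hny] using hn
  have hmb : ∀ d ∈ collect a z haz [y], ¬ d.involves b :=
    not_involves_of_mem_collect haz hP.ne.symm hbz (by simpa using hby)
  rw [← applySeq_append] at k1 k2
  have hν : Pools a b S (l ++ collect a z haz [y]) := (pools_of_closed hP.symm k1 k2).symm
  have hνb : viewFrom b root (l ++ collect a z haz [y]) = viewFrom b root l := by
    rw [viewFrom_append, viewFrom_eq_nil hmb, List.append_nil]
  have hνa : LearnsAtOnce a D S (l ++ collect a z haz [y]) :=
    ⟨z, haz, hz, by rw [viewFrom_append, viewFrom_eq_nil hla, k4]; rfl⟩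
  obtain ⟨ι, hι, i1, i2⟩ := exists_relay hP hy hy
  refine (gEquiv_same hP hca hcb hσ hι h ⟨y, hby, hy, i2⟩).trans ?_
  refine (hι.gEquiv_left hP hca hcb hμ (i1.trans hμa.symm)).trans ?_
  refine (hμ.gEquiv_right hP hca hcb hν (hμb.trans hνb.symm)).trans ?_
  have := gEquiv_same hP.symm hcb hca hν.symm hτ.symm hνa h'
  rwa [Finset.pair_comm] at this

theorem subset_applySeq_of_mem {l : List (Call A)} {e : Call A} (he : e ∈ l) {p q : A}
    (hp : e.involves p) (hq : e.involves q) (s : A → Finset A) : s p ⊆ applySeq l s q := by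
  obtain ⟨l₁, l₂, rfl⟩ := List.append_of_mem he
  rw [applySeq_append, applySeq_cons]
  refine subset_trans ?_ (subset_applySeq _ _ q)
  rw [Call.apply_of_involves hq, ← Call.apply_of_involves hp]
  exact (subset_applySeq _ _ _).trans (Call.subset_apply _ _ _)

/-- The situation reached by realizing the view of `a`, together with an agent of `D` who has
learned the secret of `a`. -/
theorem exists_realization_root (hP : Pool a b D S) {σ : List (Call A)} (hσ : Pools a b S σ)
    (hfree : ∀ d ∈ σ, ¬ (d.involves a ∧ d.involves b)) (hcall : viewFrom a root σ ≠ []) :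
    ∃ ρ, viewFrom a root ρ = viewFrom a root σ ∧ applySeq ρ root a = applySeq σ root a ∧
      Closed (applySeq ρ root a) (applySeq ρ root) ∧ Within (applySeq ρ root a) ρ ∧
      Closed S (applySeq ρ root) ∧ (∃ n ∈ D, a ∈ applySeq ρ root n) ∧
      (b ∈ applySeq ρ root a → ∃ (y : A) (hy : b ≠ y), y ≠ a ∧ y ∈ applySeq ρ root b ∧
        viewFrom b root ρ = [(⟨b, y, hy⟩, applySeq ρ root b)]) := by
  obtain ⟨ρ, h1, h2, h3, h4, -, h5⟩ := exists_realization hP.ne mem_root_self mem_root_self rfl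
    (closed_root _) hfree
  have hRS : applySeq ρ root a ⊆ S := h2 ▸ hσ.left_subset
  refine ⟨ρ, h1, h2, h3, h4, h3.mono hRS, ?_,
    h5 fun h => hP.ne (Finset.mem_singleton.1 h).symm⟩
  obtain ⟨e, he, hea⟩ : ∃ e ∈ ρ, e.involves a := by
    by_contra! hno
    exact hcall (h1 ▸ viewFrom_eq_nil hno root)
  have hebn : ¬ e.involves b := by
    intro heb
    obtain ⟨p, hp, rfl⟩ := exists_mem_viewFrom he hea root
    rw [h1] at hp
    exact hfree _ (mem_of_mem_viewFrom hp) ⟨hea, heb⟩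
  obtain ⟨n, hna, hinv, -⟩ := Call.exists_partner hea
  have hen : e.involves n := (hinv n).2 (Or.inr rfl)
  refine ⟨n, ?_, subset_applySeq_of_mem he hea hen root (mem_root_self a)⟩
  rcases (hP.mem_iff n).1 (hRS (h4.mem_of_involves he hen)) with h | rfl | h
  exacts [absurd h hna, absurd hen hebn, h]

/-- If `a` does not know the secret of `b`, the sequence can be replaced by one in which one of
the two agents learns everything in a single call. -/
theorem exists_learnsAtOnce_of_notMem (hP : Pool a b D S) (hD : D.Nonempty)
    (hca : c.involves a) (hcb : c.involves b) {σ : List (Call A)} (hσ : Pools a b S σ)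
    (hfree : ∀ d ∈ σ, ¬ (d.involves a ∧ d.involves b)) (hb : b ∉ applySeq σ root a) :
    ∃ τ, Pools a b S τ ∧ (LearnsAtOnce b D S τ ∨ LearnsAtOnce a D S τ) ∧
      GEquiv {a, b} (σ ++ [c]) (τ ++ [c]) := by
  obtain ⟨x, hx⟩ := hD
  have hax := hP.left_ne hx
  have hbx := hP.symm.left_ne hx
  have hma := not_involves_of_mem_collect hbx hP.ne hax
    (D := D.toList) (by simp [hP.left_notMem])
  by_cases hcall : viewFrom a root σ = []
  · set S' := insert b D with hS'
    have hSS' : {a} ∪ S' = S := by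
      ext n; simp [hS', hP.mem_iff, or_left_comm]
    obtain ⟨h1, h2, h3, h4⟩ := applySeq_collect hbx (S := S') (D := D.toList)
      (by simp [hP.right_notMem]) (by simp [hS']) (by simp [hS', hx])
      (by simp +contextual [hS']) (closed_root S') fun n hn => by
        rcases Finset.mem_insert.1 hn with rfl | hn
        · exact Or.inl (mem_root_self _)
        · exact Or.inr ⟨n, List.mem_cons_of_mem _ (Finset.mem_toList.2 hn), mem_root_self _⟩
    set l := collect b x hbx D.toList
    have hla : applySeq l root a = {a} := applySeq_of_not_involves hma _
    have hl : Pools a b S l := by rw [Pools, hla, h2, hSS']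
    have hxb : ¬ (⟨a, x, hax⟩ : Call A).involves b := Call.not_involves_mk _ hP.ne.symm hbx
    have hres : (⟨a, x, hax⟩ : Call A).apply (applySeq l root) a = S := by
      rw [Call.apply_left, hla, h3, hSS']
    refine ⟨l ++ [⟨a, x, hax⟩], ?_, Or.inr ⟨x, hax, hx, ?_⟩, ?_⟩
    · rw [Pools, applySeq_append, applySeq_cons, applySeq_nil, hres,
        Call.apply_of_not_involves hxb, h2, ← hSS']
      simp
    · rw [viewFrom_append, viewFrom_eq_nil hma, viewFrom_singleton (Call.involves_left _), hres]
      rfl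
    · refine (hσ.gEquiv_left hP hca hcb hl (hcall.trans (viewFrom_eq_nil hma _).symm)).trans ?_
      refine hl.gEquiv_right hP hca hcb ?_ ?_
      · rw [Pools, applySeq_append, applySeq_cons, applySeq_nil, hres,
          Call.apply_of_not_involves hxb, h2, ← hSS']
        simp
      · rw [viewFrom_append, viewFrom_singleton_of_not hxb, List.append_nil]
  · obtain ⟨ρ, r1, r2, -, r4, r5, ⟨n, hn, han⟩, -⟩ :=
      exists_realization_root hP hσ hfree hcall
    have hρb : ∀ d ∈ ρ, ¬ d.involves b := fun d hd hdb => hb (r2 ▸ r4.mem_of_involves hd hdb)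
    obtain ⟨h1, h2, -, h4⟩ := applySeq_collect hbx (D := D.toList)
      (by simp [hP.right_notMem]) hP.symm.left_mem (hP.mem_of_mem hx) hP.toList_subset r5
      fun z hz => by
        rcases (hP.mem_iff z).1 hz with rfl | rfl | hz
        · exact Or.inr ⟨n, by simp [hn], han⟩
        · exact Or.inl (mem_applySeq_self mem_root_self _ _)
        · exact Or.inr ⟨z, by simp [hz], mem_applySeq_self mem_root_self _ _⟩
    rw [← applySeq_append] at h1 h2
    have hτ := pools_of_closed hP h1 h2
    refine ⟨_, hτ, Or.inl ⟨x, hbx, hx, ?_⟩, hσ.gEquiv_left hP hca hcb hτ ?_⟩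
    · rw [viewFrom_append, viewFrom_eq_nil hρb, h4]; rfl
    · rw [viewFrom_append, viewFrom_eq_nil hma, List.append_nil, r1]

theorem exists_learnsAtOnce_of_mem (hP : Pool a b D S) (hca : c.involves a)
    (hcb : c.involves b) {σ : List (Call A)} (hσ : Pools a b S σ)
    (hfree : ∀ d ∈ σ, ¬ (d.involves a ∧ d.involves b)) (ha : a ∈ applySeq σ root b) :
    ∃ τ, Pools a b S τ ∧ (LearnsAtOnce b D S τ ∨ LearnsAtOnce a D S τ) ∧
      GEquiv {a, b} (σ ++ [c]) (τ ++ [c]) := by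
  have hcall : viewFrom b root σ ≠ [] := by
    intro h
    rw [applySeq_eq_foldl_viewFrom, h] at ha
    exact hP.ne (Finset.mem_singleton.1 ha)
  obtain ⟨ρ, r1, r2, r3, r4, r5, ⟨n, hn, hbn⟩, r6⟩ := exists_realization_root hP.symm hσ.symm
    (fun d hd h => hfree d hd h.symm) hcall
  obtain ⟨y, hay, hyb, hyr, hva⟩ := r6 (r2 ▸ ha)
  set r := applySeq ρ root a with hr
  have har : a ∈ r := mem_applySeq_self mem_root_self _ _
  have hrS : r ⊆ S := r5.1 a hP.left_mem
  have hyD : y ∈ D := by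
    rcases (hP.mem_iff y).1 (hrS hyr) with h | h | h
    exacts [absurd h.symm hay, absurd h hyb, h]
  have hby := hyb.symm
  have hyS := hP.mem_of_mem hyD
  have haDl : a ∉ D.toList := by simp [hP.left_notMem]
  have hbDl : b ∉ D.toList := by simp [hP.right_notMem]
  obtain ⟨h1, h2, -, h4⟩ := applySeq_collect hay (D := D.toList) haDl hP.left_mem hyS
    hP.toList_subset r5 fun z hz => by
      rcases (hP.mem_iff z).1 hz with rfl | rfl | hz
      · exact Or.inl har
      · exact Or.inr ⟨n, by simp [hn], hbn⟩
      · exact Or.inr ⟨z, by simp [hz], mem_applySeq_self mem_root_self _ _⟩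
  have hmb := not_involves_of_mem_collect hay hP.ne.symm hby hbDl
  rw [← applySeq_append] at h1 h2
  set τ₁ := ρ ++ collect a y hay D.toList with hτ₁
  have hp₁ : Pools a b S τ₁ := (pools_of_closed hP.symm h1 h2).symm
  have hv₁ : viewFrom a root τ₁ = [(⟨a, y, hay⟩, r), (⟨a, y, hay⟩, S)] := by
    rw [hτ₁, viewFrom_append, hva, h4]; rfl
  have g₁ : GEquiv {a, b} (σ ++ [c]) (τ₁ ++ [c]) := hσ.gEquiv_right hP hca hcb hp₁ (by
    rw [hτ₁, viewFrom_append, viewFrom_eq_nil hmb, List.append_nil, r1])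
  by_cases hbr : b ∈ r
  · set E := (r.erase a).erase b with hE
    have hyE : y ∈ E := by simp [hE, hyb, hay.symm, hyr]
    have hEr : ∀ z ∈ E.toList, z ∈ r := by simp +contextual [hE]
    have hCb : Closed r ((⟨b, y, hby⟩ : Call A).apply root) := (closed_root r).apply hbr hyr
    obtain ⟨k1, k2, -, k4⟩ := applySeq_collect hay (D := E.toList) (by simp [hE]) har hyr hEr
      hCb fun z hz => by
        by_cases hzb : z = b
        · subst hzb
          refine Or.inr ⟨y, by simp, ?_⟩
          rw [Call.apply_of_involves (Call.involves_right _)]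
          exact Finset.mem_union_left _ (mem_root_self _)
        · by_cases hza : z = a
          · subst hza
            exact Or.inl (Call.subset_apply _ _ _ (mem_root_self _))
          · exact Or.inr ⟨z, by simp [hE, hza, hzb, hz], Call.subset_apply _ _ _ (mem_root_self _)⟩
    have hEb := not_involves_of_mem_collect hay hP.ne.symm hby (D := E.toList) (by simp [hE])
    obtain ⟨l1, l2, -, l4⟩ := applySeq_collect hay (D := D.toList) haDl hP.left_mem hyS
      hP.toList_subset (k1.mono hrS) fun z hz => by
        rcases (hP.mem_iff z).1 hz with rfl | rfl | hz
        · exact Or.inl (k2 ▸ har)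
        · exact Or.inl (k2 ▸ hbr)
        · exact Or.inr ⟨z, by simp [hz],
            mem_applySeq_self (fun w => Call.subset_apply _ _ _ (mem_root_self w)) _ _⟩
    rw [← applySeq_append] at l1 l2
    set τ₂ := ⟨b, y, hby⟩ :: (collect a y hay E.toList ++ collect a y hay D.toList) with hτ₂
    have hp₂ : Pools a b S τ₂ := (pools_of_closed hP.symm l1 l2).symm
    have hya : ¬ (⟨b, y, hby⟩ : Call A).involves a := Call.not_involves_mk _ hP.ne hay
    have g₂ : GEquiv {a, b} (τ₁ ++ [c]) (τ₂ ++ [c]) := hp₁.gEquiv_left hP hca hcb hp₂ (by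
      rw [hv₁, hτ₂, viewFrom_cons_of_not hya, viewFrom_append, k4, l4]; rfl)
    obtain ⟨μ, hμ, m1, m2⟩ := exists_relay hP.symm hyD hyD
    refine ⟨μ, hμ.symm, Or.inr ⟨y, hay, hyD, m2⟩, (g₁.trans g₂).trans ?_⟩
    refine hp₂.gEquiv_right hP hca hcb hμ.symm ?_
    rw [m1, hτ₂, viewFrom_cons_of (Call.involves_left _), viewFrom_append, viewFrom_eq_nil hEb,
      viewFrom_eq_nil hmb, Call.apply_left]
    rfl
  · set E := r.erase a with hE
    have hyE : y ∈ E := by simp [hE, hay.symm, hyr]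
    obtain ⟨k1, k2, k3, k4⟩ := applySeq_collect hay (D := E.toList) (by simp [hE]) har hyr
      (by simp +contextual [hE]) (closed_root r) fun z hz => by
        by_cases hza : z = a
        · subst hza
          exact Or.inl (mem_root_self _)
        · exact Or.inr ⟨z, by simp [hE, hza, hz], mem_root_self _⟩
    have hEb := not_involves_of_mem_collect hay hP.ne.symm hby (D := E.toList)
      (by simp [hE, hbr])
    obtain ⟨l1, l2, l3, l4⟩ := applySeq_collect hby (D := D.toList) hbDl hP.symm.left_mem hyS
      hP.toList_subset (k1.mono hrS) fun z hz => by
        rcases (hP.mem_iff z).1 hz with rfl | rfl | hz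
        · exact Or.inr ⟨y, by simp, k3 ▸ har⟩
        · exact Or.inl (mem_applySeq_self mem_root_self _ _)
        · exact Or.inr ⟨z, by simp [hz], mem_applySeq_self mem_root_self _ _⟩
    rw [← applySeq_append] at l1 l2 l3
    have hma := not_involves_of_mem_collect hby hP.ne hay haDl
    set ν := collect a y hay E.toList ++ collect b y hby D.toList with hν
    have hyb' : ¬ (⟨a, y, hay⟩ : Call A).involves b := Call.not_involves_mk _ hP.ne.symm hby
    have hres : (⟨a, y, hay⟩ : Call A).apply (applySeq ν root) a = S := by
      rw [Call.apply_left, l3]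
      exact Finset.union_eq_right.2 (l1.1 a hP.left_mem)
    have hp₂ : Pools a b S (ν ++ [⟨a, y, hay⟩]) := by
      rw [Pools, applySeq_append, applySeq_cons, applySeq_nil, hres,
        Call.apply_of_not_involves hyb', l2, Finset.union_self]
    refine ⟨ν ++ [⟨a, y, hay⟩], hp₂, Or.inl ⟨y, hby, hyD, ?_⟩,
      g₁.trans (hp₁.gEquiv_left hP hca hcb hp₂ ?_)⟩
    · rw [viewFrom_append, viewFrom_singleton_of_not hyb', hν, viewFrom_append,
        viewFrom_eq_nil hEb, l4]
      rfl
    · rw [hv₁, viewFrom_append, viewFrom_singleton (Call.involves_left _), hres, hν,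
        viewFrom_append, k4, viewFrom_eq_nil hma]
      rfl

/-- Before the first call `ab`, all sequences in which `a` and `b` pool the same secrets, at
least two of them foreign, become equivalent after the call `ab`. -/
theorem gEquiv_append_first_call (hP : Pool a b D S) (hD : 1 < D.card)
    (hca : c.involves a) (hcb : c.involves b) {σ τ : List (Call A)}
    (hσ : Pools a b S σ) (hτ : Pools a b S τ)
    (hfσ : ∀ d ∈ σ, ¬ (d.involves a ∧ d.involves b))
    (hfτ : ∀ d ∈ τ, ¬ (d.involves a ∧ d.involves b)) :
    GEquiv {a, b} (σ ++ [c]) (τ ++ [c]) := by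
  have hne : D.Nonempty := Finset.card_pos.1 (by omega)
  have red : ∀ σ : List (Call A), Pools a b S σ →
      (∀ d ∈ σ, ¬ (d.involves a ∧ d.involves b)) →
      ∃ τ, Pools a b S τ ∧ (LearnsAtOnce b D S τ ∨ LearnsAtOnce a D S τ) ∧
        GEquiv {a, b} (σ ++ [c]) (τ ++ [c]) := by
    intro σ hσ hf
    by_cases ha : a ∈ applySeq σ root b
    · exact exists_learnsAtOnce_of_mem hP hca hcb hσ hf ha
    · obtain ⟨τ, h1, h2, h3⟩ := exists_learnsAtOnce_of_notMem hP.symm hne hcb hca hσ.symm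
        (fun d hd h => hf d hd h.symm) ha
      rw [Finset.pair_comm] at h3
      exact ⟨τ, h1.symm, h2.symm, h3⟩
  obtain ⟨σ', s1, s2, s3⟩ := red σ hσ hfσ
  obtain ⟨τ', t1, t2, t3⟩ := red τ hτ hfτ
  refine (s3.trans ?_).trans t3.symm
  rcases s2 with s2 | s2 <;> rcases t2 with t2 | t2
  · exact s2.gEquiv_same hP hca hcb s1 t1 t2
  · exact s2.gEquiv_swap hP hD hca hcb s1 t1 t2
  · exact (t2.gEquiv_swap hP hD hca hcb t1 s1 s2).symm
  · have := s2.gEquiv_same hP.symm hcb hca s1.symm t1.symm t2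
    rwa [Finset.pair_comm] at this

end FirstCall

section OneForeignSecret

theorem Call.not_involves_of_ne {c : Call A} {a b d : A} (had : a ≠ d) (hba : b ≠ a)
    (hbd : b ≠ d) (ha : c.involves a) (hd : c.involves d) : ¬ c.involves b := by
  unfold Call.involves at *
  grind

/-- Every call in `ρ` is a call between `d` and one of `a`, `b`. -/
def Through (a b d : A) (ρ : List (Call A)) : Prop :=
  ∀ c ∈ ρ, c.involves d ∧ (c.involves a ∨ c.involves b)

theorem Through.symm {a b d : A} {ρ : List (Call A)} (h : Through a b d ρ) :
    Through b a d ρ := fun c hc => ⟨(h c hc).1, (h c hc).2.symm⟩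

/-- As far as `a` and `b` can tell, `σ` starts with a call between `a` and `d` and continues with
calls between `d` and one of `a`, `b`. -/
def Opens (a b d : A) (σ : List (Call A)) : Prop :=
  ∃ (e : Call A) (ρ : List (Call A)), e.involves a ∧ e.involves d ∧ Through a b d ρ ∧
    viewFrom a root (e :: ρ) = viewFrom a root σ ∧ viewFrom b root (e :: ρ) = viewFrom b root σ

variable {a b d : A} {S : Finset A} {c : Call A}

theorem Pool.mid_ne (hP : Pool a b {d} S) : a ≠ d := hP.left_ne (Finset.mem_singleton_self d)

theorem Pool.mid_mem (hP : Pool a b {d} S) : d ∈ S := hP.mem_of_mem (Finset.mem_singleton_self d)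

theorem Pool.subset_of_mem (hP : Pool a b {d} S) {T : Finset A} (ha : a ∈ T) (hb : b ∈ T)
    (hd : d ∈ T) : S ⊆ T := by
  intro z hz
  rcases (hP.mem_iff z).1 hz with rfl | rfl | hz
  exacts [ha, hb, Finset.mem_singleton.1 hz ▸ hd]

theorem opens_or_opens (hP : Pool a b {d} S) {σ : List (Call A)} (hσ : Pools a b S σ)
    (hf : ∀ c ∈ σ, ¬ (c.involves a ∧ c.involves b)) : Opens a b d σ ∨ Opens b a d σ := by
  obtain ⟨l, h1, h2, h3⟩ := exists_clean S σ
  obtain ⟨ha, ha'⟩ := h3 a hσ.left_subset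
  obtain ⟨hb, hb'⟩ := h3 b hσ.symm.left_subset
  have hl : Through a b d l := by
    intro c hc
    have hn := hf c (h1 c hc)
    obtain ⟨hx, hy⟩ := h2 c hc
    rw [hP.mem_iff, Finset.mem_singleton] at hx hy
    have := c.ne
    unfold Call.involves at *
    grind
  cases l with
  | nil =>
    exfalso
    have hd := hP.mid_mem
    have h1 := hP.mid_ne
    have h2 := hP.symm.mid_ne
    rw [← hσ, ← ha', ← hb'] at hd
    simp only [applySeq_nil, root, Finset.mem_union, Finset.mem_singleton] at hd
    exact hd.elim h1.symm h2.symm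
  | cons e ρ =>
    have hρ : Through a b d ρ := fun c hc => hl c (List.mem_cons_of_mem _ hc)
    obtain ⟨hed, hea | heb⟩ := hl e List.mem_cons_self
    · exact Or.inl ⟨e, ρ, hea, hed, hρ, ha, hb⟩
    · exact Or.inr ⟨e, ρ, heb, hed, hρ.symm, hb, ha⟩

/-- Once `d` knows the secret of `a`, the agent `b` learns everything in each call. -/
theorem Through.viewFrom_eq (hP : Pool a b {d} S) {ρ : List (Call A)} (hρ : Through a b d ρ)
    {s : A → Finset A} (hs : Closed S s) (hself : ∀ x, x ∈ s x) (hd : a ∈ s d) :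
    viewFrom b s ρ = (ρ.filter (·.involves b)).map (·, S) := by
  induction ρ generalizing s with
  | nil => rfl
  | cons c ρ ih =>
    have hρ' : Through a b d ρ := fun c hc => hρ c (List.mem_cons_of_mem _ hc)
    obtain ⟨hcd, hcab⟩ := hρ c List.mem_cons_self
    have hcl : Closed S (c.apply s) := by
      rcases hcab with h | h
      · refine hs.apply ?_ ?_ <;>
        · have h1 := hP.mem_iff
          have h2 := c.ne
          have h3 := hP.mid_ne
          unfold Call.involves at *
          grind
      · refine hs.apply ?_ ?_ <;>
        · have h1 := hP.mem_iff
          have h2 := c.ne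
          have h3 := hP.symm.mid_ne
          unfold Call.involves at *
          grind
    have IH := ih hρ' hcl (fun x => Call.subset_apply _ _ _ (hself x))
      (Call.subset_apply _ _ _ hd)
    by_cases hcb : c.involves b
    · have : c.apply s b = S := by
        refine (hcl.1 b hP.symm.left_mem).antisymm (hP.subset_of_mem ?_ ?_ ?_)
        · rw [Call.apply_of_involves hcb, ← Call.apply_of_involves hcd]
          exact Call.subset_apply _ _ _ hd
        · exact Call.subset_apply _ _ _ (hself b)
        · rw [Call.apply_of_involves hcb, ← Call.apply_of_involves hcd]
          exact Call.subset_apply _ _ _ (hself d)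
      rw [viewFrom_cons_of hcb, IH, this]
      simp [hcb]
    · rw [viewFrom_cons_of_not hcb, IH]
      simp [hcb]

theorem closed_apply_root (hP : Pool a b {d} S) {e : Call A} (hea : e.involves a)
    (hed : e.involves d) : Closed S (e.apply root) := by
  have h1 := hP.mem_iff
  have h2 := e.ne
  have h3 := hP.mid_ne
  unfold Call.involves at *
  refine (closed_root S).apply ?_ ?_ <;> grind

theorem apply_root_eq (had : a ≠ d) {e : Call A} (hea : e.involves a)
    (hed : e.involves d) {x : A} (hx : e.involves x) : e.apply root x = {a, d} := by
  rw [Call.apply_of_involves hx, Call.union_eq_of_involves had hea hed]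
  rfl

/-- Agent `b` cannot tell a sequence opened by `a` from one in which `a` only makes one call. -/
theorem exists_viewFrom_eq (hP : Pool a b {d} S) {e : Call A} (hea : e.involves a)
    (hed : e.involves d) {ρ : List (Call A)} (hρ : Through a b d ρ) :
    viewFrom b root (e :: ρ) = (ρ.filter (·.involves b)).map (·, S) ∧
    viewFrom b root (e :: ρ.filter (·.involves b)) = viewFrom b root (e :: ρ) ∧
      viewFrom a root (e :: ρ.filter (·.involves b)) = [(e, {a, d})] := by
  have had := hP.mid_ne
  have hbd := hP.symm.mid_ne
  have heb := Call.not_involves_of_ne had hP.ne.symm hbd hea hed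
  have hcl := closed_apply_root hP hea hed
  have hself : ∀ x, x ∈ e.apply root x := fun x => Call.subset_apply _ _ _ (mem_root_self x)
  have hd : a ∈ e.apply root d := by rw [apply_root_eq had hea hed hed]; simp
  have hρ' : Through a b d (ρ.filter (·.involves b)) := fun c hc => hρ c (List.mem_filter.1 hc).1
  refine ⟨?_, ?_, ?_⟩
  · rw [viewFrom_cons_of_not heb, hρ.viewFrom_eq hP hcl hself hd]
  · rw [viewFrom_cons_of_not heb, viewFrom_cons_of_not heb, hρ.viewFrom_eq hP hcl hself hd,
      hρ'.viewFrom_eq hP hcl hself hd, List.filter_filter]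
    simp
  · rw [viewFrom_cons_of hea, viewFrom_eq_nil, apply_root_eq had hea hed hea]
    intro c hc
    have hcb : c.involves b := by simpa using (List.mem_filter.1 hc).2
    exact Call.not_involves_of_ne hbd hP.ne had hcb (hρ' c hc).1

theorem Opens.gEquiv_append_call (hP : Pool a b {d} S) (hca : c.involves a) (hcb : c.involves b)
    {σ τ : List (Call A)} (hσ : Pools a b S σ) (hτ : Pools a b S τ) (hoσ : Opens a b d σ)
    (hoτ : Opens a b d τ) : GEquiv {a, b} (σ ++ [c]) (τ ++ [c]) := by
  have key : ∀ σ : List (Call A), Pools a b S σ → Opens a b d σ →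
      ∃ e : Call A, ¬ e.involves b ∧ Pools a b S [e] ∧
        GEquiv {a, b} (σ ++ [c]) ([e] ++ [c]) := by
    rintro σ hσ ⟨e, ρ, hea, hed, hρ, -, hb⟩
    have had := hP.mid_ne
    obtain ⟨-, h1, h2⟩ := exists_viewFrom_eq hP hea hed hρ
    have heb := Call.not_involves_of_ne had hP.ne.symm hP.symm.mid_ne hea hed
    have hva : viewFrom a root [e] = [(e, {a, d})] := by
      rw [viewFrom_singleton hea, apply_root_eq had hea hed hea]
    have hμa : applySeq (e :: ρ.filter (·.involves b)) root a = {a, d} := by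
      rw [applySeq_eq_foldl_viewFrom, h2]; rfl
    have hμb := applySeq_eq_of_viewFrom_eq (h1.trans hb) rfl
    have hbS : b ∈ applySeq σ root b := mem_applySeq_self mem_root_self _ _
    have hS : ({a, d} : Finset A) ∪ {b} = S := by
      ext z; simp [hP.mem_iff]; tauto
    have hμ : Pools a b S (e :: ρ.filter (·.involves b)) := by
      rw [Pools, hμa, hμb]
      refine Finset.Subset.antisymm (Finset.union_subset ?_ hσ.symm.left_subset) ?_
      · rw [← hS]; exact Finset.subset_union_left
      · rw [← hS]
        exact Finset.union_subset_union_right (Finset.singleton_subset_iff.2 hbS)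
    have he : Pools a b S [e] := by
      rw [Pools, applySeq_cons, applySeq_nil, apply_root_eq had hea hed hea,
        Call.apply_of_not_involves heb]
      exact hS
    exact ⟨e, heb, he, (hσ.gEquiv_right hP hca hcb hμ (h1.trans hb).symm).trans
      (hμ.gEquiv_left hP hca hcb he (h2.trans hva.symm))⟩
  obtain ⟨e, h1, h2, h3⟩ := key σ hσ hoσ
  obtain ⟨f, k1, k2, k3⟩ := key τ hτ hoτ
  refine (h3.trans (h2.gEquiv_right hP hca hcb k2 ?_)).trans k3.symm
  rw [viewFrom_singleton_of_not h1, viewFrom_singleton_of_not k1]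

/-- The calls between `a` and `d`, with the secrets known afterwards. -/
def joint (a d : A) (s : A → Finset A) (l : List (Call A)) : List (Call A × Finset A) :=
  (viewFrom a s l).filter (·.1.involves d)

theorem joint_cons_of {s : A → Finset A} (ha : c.involves a) (hd : c.involves d)
    (l : List (Call A)) :
    joint a d s (c :: l) = (c, c.apply s a) :: joint a d (c.apply s) l := by
  simp [joint, viewFrom_cons_of ha, hd]

theorem joint_cons_of_not {s : A → Finset A} (h : ¬ (c.involves a ∧ c.involves d))
    (l : List (Call A)) : joint a d s (c :: l) = joint a d (c.apply s) l := by
  by_cases ha : c.involves a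
  · have hd : ¬ c.involves d := fun hd => h ⟨ha, hd⟩
    simp [joint, viewFrom_cons_of ha, hd]
  · simp [joint, viewFrom_cons_of_not ha]

theorem joint_comm (a d : A) (s : A → Finset A) (l : List (Call A)) :
    joint a d s l = joint d a s l := by
  induction l generalizing s with
  | nil => rfl
  | cons c l ih =>
    by_cases h : c.involves a ∧ c.involves d
    · rw [joint_cons_of h.1 h.2, joint_cons_of h.2 h.1, ih, Call.apply_of_involves h.1,
        Call.apply_of_involves h.2]
    · rw [joint_cons_of_not h, joint_cons_of_not (fun h' => h h'.symm), ih]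

theorem joint_eq_of_gEquiv {σ τ : List (Call A)} (h : GEquiv {a, d} σ τ) :
    joint a d root σ = joint a d root τ := by
  induction h with
  | refl => rfl
  | tail _ h ih =>
    refine ih.trans ?_
    obtain ⟨p, hp, h⟩ := h
    rw [agEquiv_iff] at h
    rcases Finset.mem_insert.1 hp with rfl | hp
    · simp only [joint, h]
    · rw [Finset.mem_singleton] at hp
      subst hp
      rw [joint_comm, joint_comm a]
      simp only [joint, h]

theorem mem_applySeq_of_mem_joint (hP : Pool a b {d} S) {l : List (Call A)} {s : A → Finset A}
    (hself : ∀ x, x ∈ s x) (had : a ∈ s d)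
    (hinv : ∀ x, x = a ∨ x = d → b ∈ s x → s x ⊆ S → a ∈ s b)
    {p : Call A × Finset A} (hp : p ∈ joint a d s l) (hb : b ∈ p.2) (hS : p.2 ⊆ S) :
    a ∈ applySeq l s b := by
  have hadne := hP.mid_ne
  have hba := hP.ne.symm
  have hbd := hP.symm.mid_ne
  induction l generalizing s with
  | nil => simp [joint] at hp
  | cons c l ih =>
    rw [applySeq_cons]
    have hself' : ∀ x, x ∈ c.apply s x := fun x => Call.subset_apply _ _ _ (hself x)
    have had' := Call.subset_apply c s d had
    have ha : ∀ x, x = a ∨ x = d → a ∈ s x := by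
      rintro x (rfl | rfl)
      exacts [hself _, had]
    by_cases h : c.involves a ∧ c.involves d
    · have hU : ∀ x, c.involves x → b ∈ c.apply s x → c.apply s x ⊆ S → a ∈ s b := by
        intro x hx hb hS
        rw [Call.apply_of_involves hx, Call.union_eq_of_involves hadne h.1 h.2] at hb hS
        rw [Finset.union_subset_iff] at hS
        rcases Finset.mem_union.1 hb with hb | hb
        exacts [hinv a (Or.inl rfl) hb hS.1, hinv d (Or.inr rfl) hb hS.2]
      rw [joint_cons_of h.1 h.2, List.mem_cons] at hp
      rcases hp with rfl | hp
      · exact subset_applySeq _ _ _ (Call.subset_apply _ _ _ (hU a h.1 hb hS))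
      · refine ih hself' had' (fun x hx hb hS => Call.subset_apply _ _ _ (hU x ?_ hb hS)) hp
        rcases hx with rfl | rfl
        exacts [h.1, h.2]
    · rw [joint_cons_of_not h] at hp
      refine ih hself' had' (fun x hx hbx hxS => ?_) hp
      by_cases hcx : c.involves x
      · obtain ⟨z, hzx, hz, hU⟩ := Call.exists_partner hcx
        have hcz := (hz z).2 (Or.inr rfl)
        rw [Call.apply_of_involves hcx, hU] at hbx hxS
        rw [Finset.union_subset_iff] at hxS
        rcases Finset.mem_union.1 hbx with hbx | -
        · exact Call.subset_apply _ _ _ (hinv x hx hbx hxS.1)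
        · have hzb : z = b := by
            have := (hP.mem_iff z).1 (hxS.2 (hself z))
            rw [Finset.mem_singleton] at this
            grind
          subst hzb
          rw [Call.apply_of_involves hcz, hU]
          exact Finset.mem_union_left _ (ha x hx)
      · rw [Call.apply_of_not_involves hcx] at hbx hxS
        exact Call.subset_apply _ _ _ (hinv x hx hbx hxS)

theorem mem_applySeq_of_joint_eq (hP : Pool a b {d} S) {l : List (Call A)} {s : A → Finset A}
    (hself : ∀ x, x ∈ s x) {e : Call A} {V : List (Call A × Finset A)}
    (h : joint a d s l = (e, {a, d}) :: V) {p : Call A × Finset A} (hp : p ∈ V) (hS : p.2 = S) :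
    a ∈ applySeq l s b := by
  induction l generalizing s with
  | nil => simp [joint] at h
  | cons c l ih =>
    have hself' : ∀ x, x ∈ c.apply s x := fun x => Call.subset_apply _ _ _ (hself x)
    rw [applySeq_cons]
    by_cases hc : c.involves a ∧ c.involves d
    · rw [joint_cons_of hc.1 hc.2] at h
      simp only [List.cons.injEq, Prod.mk.injEq] at h
      obtain ⟨⟨-, h1⟩, rfl⟩ := h
      have h2 : c.apply s d = {a, d} := by
        rw [← h1, Call.apply_of_involves hc.1, Call.apply_of_involves hc.2]
      refine mem_applySeq_of_mem_joint hP hself' (by simp [h2]) ?_ hp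
        (hS ▸ hP.symm.left_mem) hS.subset
      rintro x (rfl | rfl) hb <;> exfalso
      · rw [h1] at hb
        simp [hP.ne.symm, hP.symm.mid_ne] at hb
      · rw [h2] at hb
        simp [hP.ne.symm, hP.symm.mid_ne] at hb
    · rw [joint_cons_of_not hc] at h
      exact ih hself' h

/-- The pair-view reveals which of `a`, `b` was the first to call `d`. -/
theorem Opens.not_opens (hP : Pool a b {d} S) {σ τ : List (Call A)} (hσ : Opens a b d σ)
    (hτ : Opens b a d τ) (ha : applySeq σ root a = applySeq τ root a) :
    pairView σ a d ≠ pairView τ a d := by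
  intro hpv
  have had := hP.mid_ne
  have hbd := hP.symm.mid_ne
  obtain ⟨e, ρ, hea, hed, hρ, hσa, -⟩ := hσ
  obtain ⟨f, π, hfb, hfd, hπ, -, hτa⟩ := hτ
  obtain ⟨h1, h2, h3⟩ := exists_viewFrom_eq hP.symm hfb hfd hπ
  have hσs := applySeq_eq_of_viewFrom_eq hσa rfl
  have hd : d ∈ applySeq σ root a := by
    rw [← hσs, applySeq_cons]
    refine subset_applySeq _ _ _ ?_
    rw [apply_root_eq had hea hed hea]
    simp
  have hS : applySeq σ root a = S := by
    rcases applySeq_eq_or_exists_mem_viewFrom a τ root with h | ⟨p, hp, h⟩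
    · rw [ha, h] at hd
      exact absurd (Finset.mem_singleton.1 hd) had.symm
    · rw [← hτa, h1] at hp
      obtain ⟨_, _, rfl⟩ := List.mem_map.1 hp
      rw [ha, ← h]
  rw [← hσs, applySeq_cons] at hS
  obtain ⟨p, hp, hpS⟩ : ∃ p ∈ joint a d (e.apply root) ρ, p.2 = S := by
    rcases applySeq_eq_or_exists_mem_viewFrom a ρ (e.apply root) with h | ⟨p, hp, h⟩
    · rw [h, apply_root_eq had hea hed hea] at hS
      have := hP.symm.left_mem
      rw [← hS] at this
      simp [hP.ne.symm, hbd] at this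
    · refine ⟨p, List.mem_filter.2 ⟨hp, ?_⟩, h.trans hS⟩
      simpa using (hρ _ (mem_of_mem_viewFrom hp)).1
  have hj : joint a d root σ = (e, {a, d}) :: joint a d (e.apply root) ρ := by
    have : joint a d root σ = joint a d root (e :: ρ) := by simp only [joint, hσa]
    rw [this, joint_cons_of hea hed, apply_root_eq had hea hed hea]
  have hmem : applySeq (f :: π.filter (·.involves a)) root ∈ pairView τ a d :=
    ⟨_, .of_viewFrom_eq (a := a) (by simp) (hτa.symm.trans h2.symm), rfl⟩
  rw [← hpv] at hmem
  obtain ⟨υ, hυ, hυs⟩ := hmem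
  have hab := mem_applySeq_of_joint_eq hP mem_root_self
    ((joint_eq_of_gEquiv hυ).symm.trans hj) hp hpS
  rw [← hυs, applySeq_eq_foldl_viewFrom, h3] at hab
  simp [hP.ne, had] at hab

end OneForeignSecret

section Composition

variable {a b : A} {c : Call A} {σ τ : List (Call A)}

theorem mem_pairView_of_gEquiv (h : GEquiv {a, b} σ τ) : applySeq τ root ∈ pairView σ a b :=
  ⟨τ, h, rfl⟩

theorem pairView_subset_of_gEquiv (h : GEquiv {a, b} τ σ) : pairView σ a b ⊆ pairView τ a b := by
  rintro s ⟨υ, hυ, rfl⟩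
  exact mem_pairView_of_gEquiv (h.trans hυ)

theorem pairView_eq_of_gEquiv (h : GEquiv {a, b} σ τ) : pairView σ a b = pairView τ a b :=
  (pairView_subset_of_gEquiv h.symm).antisymm (pairView_subset_of_gEquiv h)

theorem viewFrom_eq_of_gEquiv_self (h : GEquiv {a, a} σ τ) :
    viewFrom a root σ = viewFrom a root τ := by
  induction h with
  | refl => rfl
  | tail _ h ih =>
    obtain ⟨p, hp, h⟩ := h
    obtain rfl : p = a := by simpa using hp
    exact ih.trans (agEquiv_iff.1 h)

theorem pairView_self_append_call_subset (hc : c.involves a)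
    (hv : pairView σ a a = pairView τ a a) (hs : applySeq σ root = applySeq τ root) :
    pairView (σ ++ [c]) a a ⊆ pairView (τ ++ [c]) a a := by
  rintro s ⟨υ, hυ, rfl⟩
  have h := (viewFrom_eq_of_gEquiv_self hυ).symm
  rw [viewFrom_append, viewFrom_singleton hc] at h
  obtain ⟨υ₀, ρ, rfl, h1, h2, h3⟩ := exists_split_of_viewFrom_eq h
  have hmem : applySeq υ₀ root ∈ pairView σ a a :=
    mem_pairView_of_gEquiv (.of_viewFrom_eq (a := a) (by simp) h1.symm)
  rw [hv] at hmem
  obtain ⟨τ₁, hτ₁, hτs⟩ := hmem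
  refine ⟨τ₁ ++ c :: ρ, .of_viewFrom_eq (a := a) (by simp) ?_, ?_⟩
  · rw [viewFrom_append, viewFrom_append, viewFrom_eq_of_gEquiv_self hτ₁, viewFrom_singleton hc,
      viewFrom_cons_of hc, viewFrom_eq_nil (not_involves_of_viewFrom_eq_nil h3), ← hs, ← hτs, h2]
  · rw [applySeq_append, applySeq_append, hτs]

theorem exists_last_call {l : List (Call A)} (h : ∃ e ∈ l, e.involves a ∧ e.involves b) :
    ∃ l₁ e l₂, l = l₁ ++ e :: l₂ ∧ e.involves a ∧ e.involves b ∧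
      ∀ d ∈ l₂, ¬ (d.involves a ∧ d.involves b) := by
  induction l with
  | nil => simp at h
  | cons c l ih =>
    by_cases hl : ∃ e ∈ l, e.involves a ∧ e.involves b
    · obtain ⟨l₁, e, l₂, rfl, h'⟩ := ih hl
      exact ⟨c :: l₁, e, l₂, rfl, h'⟩
    · push Not at hl
      obtain ⟨e, he, hea, heb⟩ := h
      rcases List.mem_cons.1 he with rfl | he
      · exact ⟨[], e, l, rfl, hea, heb, fun d hd hd' => hl d hd hd'.1 hd'.2⟩
      · exact absurd heb (hl e he hea)

theorem pairView_append_call_subset_of_occurs (hab : a ≠ b) (hca : c.involves a)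
    (hcb : c.involves b) (hocc : ∃ e ∈ τ, e.involves a ∧ e.involves b)
    (hv : pairView σ a b = pairView τ a b) (hs : applySeq σ root = applySeq τ root) :
    pairView (σ ++ [c]) a b ⊆ pairView (τ ++ [c]) a b := by
  rintro s ⟨υ, hυ, rfl⟩
  obtain ⟨υ₀, ρ, rfl, hρ, hσυ, hlink⟩ := exists_split_of_gEquiv hca hcb (ρ := []) (by simp) hυ
  have hres : applySeq (σ ++ [c]) root a = applySeq (υ₀ ++ [c]) root a := by
    clear hυ hσυ
    induction hlink with
    | refl => rfl
    | tail _ h ih =>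
      obtain ⟨p, hp, h⟩ := h
      exact ih.trans (applySeq_eq_of_viewFrom_eq_of_call hca hcb hp h)
  have hmem := mem_pairView_of_gEquiv hσυ
  rw [hv] at hmem
  obtain ⟨τ₁, hτ₁, hτs⟩ := hmem
  have hun : applySeq τ root a ∪ applySeq τ root b = applySeq τ₁ root a ∪ applySeq τ₁ root b := by
    simp only [applySeq_append, applySeq_cons, applySeq_nil] at hres
    rwa [Call.apply_of_involves hca, Call.apply_of_involves hca,
      Call.union_eq_of_involves hab hca hcb, Call.union_eq_of_involves hab hca hcb, hs,
      hτs] at hres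
  obtain ⟨τ₀, e, π, rfl, hea, heb, hπ⟩ := exists_last_call hocc
  refine ⟨τ₁ ++ [c] ++ ρ, ?_, ?_⟩
  · exact (gEquiv_append_call_of_occurs hab hca hcb hea heb hπ hτ₁ hun).trans
      (gEquiv_append_of_not_both hρ _).symm
  · rw [List.append_assoc, applySeq_append, applySeq_append, hτs]
    rfl

theorem exists_call_of_pairView_eq (hab : a ≠ b) (hocc : ∃ e ∈ σ, e.involves a ∧ e.involves b)
    (hv : pairView σ a b = pairView τ a b) : ∃ e ∈ τ, e.involves a ∧ e.involves b := by
  by_contra! hno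
  have hmem : applySeq [] root ∈ pairView τ a b := mem_pairView_of_gEquiv
    (gEquiv_append_of_not_both (ρ := τ) (fun e he h => hno e he h.1 h.2) [])
  rw [← hv] at hmem
  obtain ⟨υ, hυ, hυs⟩ := hmem
  obtain ⟨σ₀, e, ρ, rfl, hea, heb, hρ⟩ := exists_last_call hocc
  obtain ⟨υ₀, ρ', rfl, -⟩ := exists_split_of_gEquiv hea heb hρ hυ
  have := subset_applySeq_of_mem (l := υ₀ ++ e :: ρ') (by simp) heb hea root (mem_root_self b)
  rw [← hυs] at this
  exact hab (Finset.mem_singleton.1 this).symm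

theorem gEquiv_append_call_of_not_occurs (hab : a ≠ b) (hca : c.involves a)
    (hcb : c.involves b) (hσ : ∀ e ∈ σ, ¬ (e.involves a ∧ e.involves b))
    (hτ : ∀ e ∈ τ, ¬ (e.involves a ∧ e.involves b))
    (hv : pairView σ = pairView τ) (hs : applySeq σ root = applySeq τ root) :
    GEquiv {a, b} (σ ++ [c]) (τ ++ [c]) := by
  set S := applySeq σ root a ∪ applySeq σ root b with hS
  have hpσ : Pools a b S σ := rfl
  have hpτ : Pools a b S τ := by rw [Pools, ← hs]
  have haS : a ∈ S := hpσ.left_subset (mem_applySeq_self mem_root_self _ _)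
  have hbS : b ∈ S := hpσ.symm.left_subset (mem_applySeq_self mem_root_self _ _)
  set D := (S.erase a).erase b with hD
  have hP : Pool a b D S := ⟨hab, by simp [hD], by simp [hD], fun z => by
    by_cases hza : z = a
    · simp [hza, haS]
    · by_cases hzb : z = b
      · simp [hzb, hbS]
      · simp [hD, hza, hzb]⟩
  clear_value D
  obtain h0 | h1 | h2 : D.card = 0 ∨ D.card = 1 ∨ 1 < D.card := by omega
  · rw [Finset.card_eq_zero] at h0
    subst h0
    have hnil : ∀ υ : List (Call A), Pools a b S υ →
        (∀ e ∈ υ, ¬ (e.involves a ∧ e.involves b)) → viewFrom a root υ = [] := by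
      refine fun υ hυ hf => viewFrom_eq_nil (fun e he hea => ?_) _
      obtain ⟨z, hza, hz, -⟩ := Call.exists_partner hea
      have hez := (hz z).2 (Or.inr rfl)
      have hzS := hυ.left_subset (subset_applySeq_of_mem he hez hea root (mem_root_self z))
      rcases (hP.mem_iff z).1 hzS with rfl | rfl | hz
      exacts [hza rfl, hf e he ⟨hea, hez⟩, absurd hz (Finset.notMem_empty z)]
    exact hpσ.gEquiv_left hP hca hcb hpτ ((hnil σ hpσ hσ).trans (hnil τ hpτ hτ).symm)
  · obtain ⟨d, rfl⟩ := Finset.card_eq_one.1 h1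
    rcases opens_or_opens hP hpσ hσ with hoσ | hoσ <;>
      rcases opens_or_opens hP hpτ hτ with hoτ | hoτ
    · exact hoσ.gEquiv_append_call hP hca hcb hpσ hpτ hoτ
    · exact absurd (congrFun₂ hv a d) (hoσ.not_opens hP hoτ (congrFun hs a))
    · exact absurd (congrFun₂ hv b d) (hoσ.not_opens hP.symm hoτ (congrFun hs b))
    · have := hoσ.gEquiv_append_call hP.symm hcb hca hpσ.symm hpτ.symm hoτ
      rwa [Finset.pair_comm] at this
  · exact gEquiv_append_first_call hP h2 hca hcb hpσ hpτ hσ hτ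

theorem pairView_append_call_subset (hv : pairView σ = pairView τ)
    (hs : applySeq σ root = applySeq τ root) (c : Call A) (a b : A) :
    pairView (σ ++ [c]) a b ⊆ pairView (τ ++ [c]) a b := by
  by_cases hca : c.involves a
  · by_cases hcb : c.involves b
    · by_cases hab : a = b
      · subst hab
        exact pairView_self_append_call_subset hca (congrFun₂ hv a a) hs
      · by_cases hτ : ∃ e ∈ τ, e.involves a ∧ e.involves b
        · exact pairView_append_call_subset_of_occurs hab hca hcb hτ (congrFun₂ hv a b) hs
        · have hσ : ¬ ∃ e ∈ σ, e.involves a ∧ e.involves b :=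
            fun h => hτ (exists_call_of_pairView_eq hab h (congrFun₂ hv a b))
          exact (pairView_eq_of_gEquiv (gEquiv_append_call_of_not_occurs hab hca hcb
            (fun e he h => hσ ⟨e, he, h⟩) (fun e he h => hτ ⟨e, he, h⟩) hv hs)).subset
    · have h := fun υ : List (Call A) => pairView_eq_of_gEquiv
        (gEquiv_append_of_not_involves (G := {a, b}) (a := b) (by simp) hcb υ)
      rw [h, h, hv]
  · have h := fun υ : List (Call A) => pairView_eq_of_gEquiv
      (gEquiv_append_of_not_involves (G := {a, b}) (a := a) (by simp) hca υ)
    rw [h, h, hv]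

/-- The pair-view is compositional. -/
theorem fullView_append (h : fullView σ = fullView τ) (ρ : List (Call A)) :
    fullView (σ ++ ρ) = fullView (τ ++ ρ) := by
  induction ρ generalizing σ τ with
  | nil => simpa using h
  | cons c ρ ih =>
    rw [List.append_cons, List.append_cons τ]
    obtain ⟨hv, hs⟩ := Prod.mk.inj h
    refine ih (Prod.ext ?_ ?_)
    · funext a b
      exact (pairView_append_call_subset hv hs c a b).antisymm
        (pairView_append_call_subset hv.symm hs.symm c a b)
    · simp only [fullView, applySeq_append, hs]

theorem exists_pairNonRedundant (σ : List (Call A)) :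
    ∃ τ, PairNonRedundant τ ∧ fullView σ = fullView τ := by
  induction hn : σ.length using Nat.strong_induction_on generalizing σ with
  | _ n ih =>
    by_cases hσ : PairNonRedundant σ
    · exact ⟨σ, hσ, rfl⟩
    · simp only [PairNonRedundant, not_forall, not_not] at hσ
      obtain ⟨σ₁, σ₂, ⟨σ₃, rfl⟩, hne, heq⟩ := hσ
      have hpos := List.length_pos_iff.2 hne
      obtain ⟨τ, hτ, h⟩ := ih (σ₁ ++ σ₃).length (by simp at hn ⊢; omega) _ rfl
      exact ⟨τ, hτ, (fullView_append heq.symm σ₃).trans h⟩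

theorem sat_iff_of_ckFree (hs : applySeq σ root = applySeq τ root) (φ : Formula A)
    (hφ : CkFree φ) : Sat φ σ ↔ Sat φ τ := by
  induction φ with
  | fam a p => simp only [Sat, hs]
  | neg φ ih => exact not_congr (ih hφ)
  | conj φ ψ ih₁ ih₂ => exact and_congr (ih₁ hφ.1) (ih₂ hφ.2)
  | ck G φ => exact hφ.elim

theorem gEquiv_nil_of_two_lt_card {G : Finset A} (hG : 2 < G.card) (σ : List (Call A)) :
    GEquiv G σ [] := by
  obtain ⟨x, y, z, hx, hy, hz, hxy, hxz, hyz⟩ := Finset.two_lt_card_iff.1 hG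
  induction σ using List.reverseRecOn with
  | nil => exact .refl
  | append_singleton σ c ih =>
    obtain ⟨g, hg, hcg⟩ : ∃ g ∈ G, ¬ c.involves g := by
      by_contra! h
      have h1 := h x hx
      have h2 := h y hy
      have h3 := h z hz
      unfold Call.involves at *
      grind
    exact (gEquiv_append_of_not_involves hg hcg σ).trans ih

theorem exists_gEquiv_of_fullView_eq (h : fullView σ = fullView τ) {G : Finset A}
    {υ : List (Call A)} (hυ : GEquiv G σ υ) :
    ∃ υ', GEquiv G τ υ' ∧ applySeq υ root = applySeq υ' root := by
  obtain ⟨hv, hs⟩ := Prod.mk.inj h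
  have pair : ∀ a b : A, GEquiv {a, b} σ υ →
      ∃ υ', GEquiv {a, b} τ υ' ∧ applySeq υ root = applySeq υ' root := by
    intro a b hυ
    have hmem := mem_pairView_of_gEquiv hυ
    rwa [hv] at hmem
  obtain h0 | h1 | h2 | h3 : G.card = 0 ∨ G.card = 1 ∨ G.card = 2 ∨ 2 < G.card := by omega
  · rw [Finset.card_eq_zero] at h0
    subst h0
    refine ⟨τ, .refl, ?_⟩
    rw [← hs]
    clear h hv hs pair
    induction hυ with
    | refl => rfl
    | tail _ h => simp at h
  · obtain ⟨a, rfl⟩ := Finset.card_eq_one.1 h1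
    simpa using pair a a (by simpa using hυ)
  · obtain ⟨a, b, -, rfl⟩ := Finset.card_eq_two.1 h2
    exact pair a b hυ
  · exact ⟨υ, (gEquiv_nil_of_two_lt_card h3 τ).trans (gEquiv_nil_of_two_lt_card h3 υ).symm, rfl⟩

theorem sat_iff_of_fullView_eq (h : fullView σ = fullView τ) (φ : Formula A)
    (hφ : NoNested φ) : Sat φ σ ↔ Sat φ τ := by
  induction φ with
  | fam a p => exact sat_iff_of_ckFree (Prod.mk.inj h).2 _ trivial
  | neg φ ih => exact not_congr (ih hφ)
  | conj φ ψ ih₁ ih₂ => exact and_congr (ih₁ hφ.1) (ih₂ hφ.2)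
  | ck G φ =>
    constructor <;> intro hsat υ hυ
    · obtain ⟨υ', h1, h2⟩ := exists_gEquiv_of_fullView_eq h.symm hυ
      exact (sat_iff_of_ckFree h2 φ hφ).2 (hsat υ' h1)
    · obtain ⟨υ', h1, h2⟩ := exists_gEquiv_of_fullView_eq h hυ
      exact (sat_iff_of_ckFree h2 φ hφ).2 (hsat υ' h1)

end Composition

theorem stmt15 {A : Type} [DecidableEq A] [Fintype A] (hA : 3 ≤ Fintype.card A)
    (σ : List (Call A)) :
    ∃ τ : List (Call A), PairNonRedundant τ ∧
      ∀ φ : Formula A, NoNested φ → (Sat φ σ ↔ Sat φ τ) := by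
  obtain ⟨τ, hτ, h⟩ := exists_pairNonRedundant σ
  exact ⟨τ, hτ, fun φ hφ => sat_iff_of_fullView_eq h φ hφ⟩

end Gossip
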